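/- For any finite non-cyclic group G we have β(G) ≤ (3/4) · |G|. -/

import Mathlib

/-!  Definition of the Noether number `β(G)` of a group `G`, over the field `ℂ`
(of characteristic 0).  A finite-dimensional `ℂG`-module is (up to isomorphism)
given by a representation `ρ : Representation ℂ G (Fin n → ℂ)`; the algebra of
polynomial invariants is realised inside `MvPolynomial (Fin n) ℂ` as the
common equalizer of the substitution maps induced by the group elements. -/

/-- The algebra endomorphism of the polynomial ring induced by the linear action of
`g : G` on the underlying space (substitution of the variables by linear forms). -/
noncomputable def Representation.polySubst {G : Type*} [Group G] {n : ℕ}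
    (ρ : Representation ℂ G (Fin n → ℂ)) (g : G) :
    MvPolynomial (Fin n) ℂ →ₐ[ℂ] MvPolynomial (Fin n) ℂ :=
  MvPolynomial.aeval fun i =>
    ∑ j, MvPolynomial.C (LinearMap.toMatrix' (ρ g) i j) * MvPolynomial.X j

/-- The subalgebra of `G`-invariant polynomials. -/
noncomputable def Representation.invariantAlgebra {G : Type*} [Group G] {n : ℕ}
    (ρ : Representation ℂ G (Fin n → ℂ)) : Subalgebra ℂ (MvPolynomial (Fin n) ℂ) :=
  ⨅ g : G, AlgHom.equalizer (ρ.polySubst g) (AlgHom.id ℂ (MvPolynomial (Fin n) ℂ))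

/-- The invariant algebra is generated by its elements of (total) degree at most `d`. -/
def Representation.InvariantsGeneratedInDegree {G : Type*} [Group G] {n : ℕ}
    (ρ : Representation ℂ G (Fin n → ℂ)) (d : ℕ) : Prop :=
  Algebra.adjoin ℂ {f : MvPolynomial (Fin n) ℂ | f ∈ ρ.invariantAlgebra ∧ f.totalDegree ≤ d}
    = ρ.invariantAlgebra

/-- The Noether number `β(G)`: the smallest degree bound `d` such that for every
finite-dimensional `ℂG`-module the algebra of polynomial invariants is generated
by its elements of degree at most `d`.  (Equivalently, the maximum over all
finite-dimensional modules `V` of the minimal generating degree `β(G,V)`.) -/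
noncomputable def noetherNumber (G : Type*) [Group G] : ℕ :=
  sInf {d : ℕ | ∀ (n : ℕ) (ρ : Representation ℂ G (Fin n → ℂ)),
    ρ.InvariantsGeneratedInDegree d}

/-- The Noether index `n(G) = |G| / β(G)`, as a real number. -/
noncomputable def noetherIndex (G : Type*) [Group G] : ℝ :=
  (Nat.card G : ℝ) / (noetherNumber G : ℝ)



/-- `HasHilbertBound G d` says that, for every action of `G` on a commutative `ℂ`-algebra, the
`d`-th power of a stable ideal `I` is contained in the ideal generated by the invariants in `I`. -/
def HasHilbertBound (G : Type) [Group G] (d : ℕ) : Prop :=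
  ∀ (A : Type) [CommRing A] [Algebra ℂ A] (φ : G →* (A →ₐ[ℂ] A)) (I : Ideal A),
    (∀ g, ∀ a ∈ I, φ g a ∈ I) → I ^ d ≤ Ideal.span {a | a ∈ I ∧ ∀ g, φ g a = a}

theorem HasHilbertBound.mono {G : Type} [Group G] {d e : ℕ} (h : HasHilbertBound G d)
    (hde : d ≤ e) : HasHilbertBound G e :=
  fun A _ _ φ I hI => (Ideal.pow_le_pow_right hde).trans (h A φ I hI)

theorem Ideal.span_pow_le_of_prod_mem {A ι : Type*} [CommRing A] [Fintype ι] {X : Set A}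
    {J : Ideal A} (h : ∀ x : ι → A, (∀ i, x i ∈ X) → ∏ i, x i ∈ J) :
    Ideal.span X ^ Fintype.card ι ≤ J := by
  have h1 := Submodule.span_pow (R := A) X (Fintype.card ι)
  change Submodule.span A X ^ _ ≤ _
  rw [h1, Submodule.span_le]
  intro a ha
  obtain ⟨f, rfl⟩ := Set.mem_pow.1 ha
  have h2 := h (fun i => (f (Fintype.equivFin ι i) : A)) fun i => (f (Fintype.equivFin ι i)).2
  rw [List.prod_ofFn]
  rwa [Equiv.prod_comp (Fintype.equivFin ι) (fun i => (f i : A))] at h2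

theorem Ideal.mem_of_natCast_mul_mem {A : Type*} [CommRing A] [Algebra ℂ A] {J : Ideal A}
    {n : ℕ} (hn : n ≠ 0) {a : A} (h : (n : A) * a ∈ J) : a ∈ J := by
  have h1 : a = algebraMap ℂ A (n : ℂ)⁻¹ * ((n : A) * a) := by
    rw [← mul_assoc, ← map_natCast (algebraMap ℂ A) n, ← map_mul,
      inv_mul_cancel₀ (Nat.cast_ne_zero.2 hn), map_one, one_mul]
  rw [h1]
  exact J.mul_mem_left _ h

section Action

variable {G A : Type} [Group G] [CommRing A] [Algebra ℂ A] (φ : G →* (A →ₐ[ℂ] A))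

theorem map_mul_apply_of_action (g h : G) (a : A) : φ (g * h) a = φ g (φ h a) := by
  rw [map_mul]; rfl

/-- A relative form of Benson's lemma. -/
theorem prod_mem_span_invariants [Finite G] (H : Subgroup G) [Fintype (G ⧸ H)] (I : Ideal A)
    (hI : ∀ g, ∀ a ∈ I, φ g a ∈ I) (x : G ⧸ H → A) (hx : ∀ c, x c ∈ I)
    (hxH : ∀ c, ∀ h ∈ H, φ h (x c) = x c) :
    ∏ c, x c ∈ Ideal.span {a | a ∈ I ∧ ∀ g, φ g a = a} := by
  classical
  have := Fintype.ofFinite G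
  set J := Ideal.span {a | a ∈ I ∧ ∀ g, φ g a = a} with hJ
  have key : ∑ g : G, ∏ c : G ⧸ H, (φ (g * c.out) (x c) + -x c) = 0 := by
    refine Finset.sum_eq_zero fun g _ => ?_
    refine Finset.prod_eq_zero (Finset.mem_univ ((g⁻¹ : G) : G ⧸ H)) ?_
    rw [hxH, add_neg_cancel]
    have := QuotientGroup.mk_out_eq_mul H g⁻¹
    obtain ⟨h, hh⟩ := this
    rw [hh]
    simp
  simp_rw [Finset.prod_add] at key
  rw [Finset.sum_comm, ← Finset.add_sum_erase _ _
    (Finset.empty_mem_powerset (Finset.univ : Finset (G ⧸ H)))] at key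
  have h1 : ∑ t ∈ (Finset.univ : Finset (G ⧸ H)).powerset.erase ∅, ∑ g : G,
      (∏ c ∈ t, φ (g * c.out) (x c)) * ∏ c ∈ Finset.univ \ t, -x c ∈ J := by
    refine J.sum_mem fun t ht => ?_
    rw [← Finset.sum_mul]
    refine J.mul_mem_right _ (Ideal.subset_span ⟨I.sum_mem fun g _ => ?_, fun k => ?_⟩)
    · obtain ⟨c, hc⟩ := Finset.nonempty_iff_ne_empty.2 (Finset.ne_of_mem_erase ht)
      exact I.mem_of_dvd (Finset.dvd_prod_of_mem _ hc) (hI _ _ (hx c))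
    · rw [map_sum]
      refine Fintype.sum_equiv (Equiv.mulLeft k) _ _ fun g => ?_
      rw [map_prod]
      refine Finset.prod_congr rfl fun c _ => ?_
      rw [← map_mul_apply_of_action, Equiv.coe_mulLeft, mul_assoc]
  have h2 : (Fintype.card G : A) * ∏ c, x c ∈ J := by
    simp only [Finset.prod_empty, Finset.sdiff_empty, one_mul, Finset.sum_const,
      Finset.card_univ, nsmul_eq_mul] at key
    rw [Finset.prod_neg, Finset.card_univ] at key
    have h3 : (Fintype.card G : A) * ((-1) ^ Fintype.card (G ⧸ H) * ∏ c, x c) ∈ J := by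
      rw [eq_neg_of_add_eq_zero_left key]
      exact J.neg_mem h1
    have h4 := J.mul_mem_left ((-1) ^ Fintype.card (G ⧸ H)) h3
    have h5 : (-1 : A) ^ Fintype.card (G ⧸ H) * (-1) ^ Fintype.card (G ⧸ H) = 1 := by
      rw [← mul_pow]; simp
    convert h4 using 1
    linear_combination (-(Fintype.card G : A) * ∏ c, x c) * h5
  exact Ideal.mem_of_natCast_mul_mem Fintype.card_ne_zero h2

theorem span_invariants_pow_index_le [Finite G] (H : Subgroup G) (I : Ideal A)
    (hI : ∀ g, ∀ a ∈ I, φ g a ∈ I) :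
    Ideal.span {a | a ∈ I ∧ ∀ h ∈ H, φ h a = a} ^ H.index ≤
      Ideal.span {a | a ∈ I ∧ ∀ g, φ g a = a} := by
  have := Fintype.ofFinite (G ⧸ H)
  rw [Subgroup.index, Nat.card_eq_fintype_card]
  exact Ideal.span_pow_le_of_prod_mem fun x hx =>
    prod_mem_span_invariants φ H I hI x (fun c => (hx c).1) fun c => (hx c).2

end Action

theorem HasHilbertBound.of_subgroup {G : Type} [Group G] [Finite G] (H : Subgroup G) {d : ℕ}
    (h : HasHilbertBound H d) : HasHilbertBound G (d * H.index) := by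
  intro A _ _ φ I hI
  rw [pow_mul]
  refine (Ideal.pow_right_mono ?_ _).trans (span_invariants_pow_index_le φ H I hI)
  refine (h A (φ.comp H.subtype) I fun g => hI g).trans (Ideal.span_mono ?_)
  exact fun a ha => ⟨ha.1, fun g hg => ha.2 ⟨g, hg⟩⟩

theorem hasHilbertBound_card (G : Type) [Group G] [Finite G] : HasHilbertBound G (Nat.card G) := by
  have h : HasHilbertBound (⊥ : Subgroup G) 1 := by
    intro A _ _ φ I hI
    rw [pow_one]
    intro a ha
    refine Ideal.subset_span ⟨ha, fun g => ?_⟩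
    rw [Subsingleton.elim g 1, map_one, AlgHom.one_apply]
  simpa using h.of_subgroup

theorem HasHilbertBound.of_quotient {G : Type} [Group G] (N : Subgroup G) [N.Normal]
    {d e : ℕ} (hN : HasHilbertBound N d) (hQ : HasHilbertBound (G ⧸ N) e) :
    HasHilbertBound G (d * e) := by
  intro A _ _ φ I hI
  let B : Subalgebra ℂ A :=
    { carrier := {a | ∀ h ∈ N, φ h a = a}
      mul_mem' := fun ha hb h hh => by rw [map_mul, ha h hh, hb h hh]
      add_mem' := fun ha hb h hh => by rw [map_add, ha h hh, hb h hh]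
      algebraMap_mem' := fun r h _ => AlgHom.commutes _ _ }
  have hB : ∀ g, ∀ a ∈ B, φ g a ∈ B := fun g a ha h hh => by
    have : h * g = g * (g⁻¹ * h * g) := by group
    rw [← map_mul_apply_of_action, this, map_mul_apply_of_action, ha]
    simpa using ‹N.Normal›.conj_mem h hh g⁻¹
  let ψ : G →* (B →ₐ[ℂ] B) :=
    { toFun := fun g => ((φ g).comp B.val).codRestrict B fun a => hB g a a.2
      map_one' := by ext a; simp
      map_mul' := fun g h => by
        ext a
        exact map_mul_apply_of_action φ g h a }
  have hψ : ∀ g (b : B), (ψ g b : A) = φ g b := fun g b => rfl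
  have hker : N ≤ ψ.ker := fun h hh => by
    rw [MonoidHom.mem_ker]
    ext b
    exact b.2 h hh
  let I' : Ideal B := I.comap B.val
  have h1 : I ^ d ≤ I'.map B.val := by
    refine (hN A (φ.comp N.subtype) I fun g => hI g).trans (Ideal.span_le.2 ?_)
    intro a ha
    exact Ideal.mem_map_of_mem B.val
      (show (⟨a, fun h hh => ha.2 ⟨h, hh⟩⟩ : B) ∈ I' from ha.1)
  have h2 := hQ B (QuotientGroup.lift N ψ hker) I' fun g => by
    induction g using QuotientGroup.induction_on with
    | H g => exact fun b hb => hI g b hb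
  rw [pow_mul]
  refine (Ideal.pow_right_mono h1 e).trans ?_
  rw [← Ideal.map_pow]
  refine (Ideal.map_mono h2).trans ?_
  rw [Ideal.map_span, Ideal.span_le]
  rintro _ ⟨b, ⟨hb, hb'⟩, rfl⟩
  exact Ideal.subset_span ⟨hb, fun g => congrArg Subtype.val (hb' (g : G ⧸ N))⟩

section Polynomial

open MvPolynomial

variable {G : Type} [Group G] {n : ℕ}

theorem MvPolynomial.apply_homogeneousComponent_of_isHomogeneous
    (f : MvPolynomial (Fin n) ℂ →ₐ[ℂ] MvPolynomial (Fin n) ℂ)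
    (hf : ∀ i, (f (X i)).IsHomogeneous 1) (m : ℕ) (p : MvPolynomial (Fin n) ℂ) :
    f (homogeneousComponent m p) = homogeneousComponent m (f p) := by
  have hhom : ∀ k (q : MvPolynomial (Fin n) ℂ), q.IsHomogeneous k → (f q).IsHomogeneous k := by
    intro k q hq
    have h1 := hq.aeval (f ∘ X) hf
    rwa [one_mul, ← MvPolynomial.aeval_unique f] at h1
  conv_rhs => rw [← sum_homogeneousComponent p, map_sum, map_sum]
  have h : ∀ i, homogeneousComponent m (f (homogeneousComponent i p)) =
      if m = i then f (homogeneousComponent i p) else 0 := fun i =>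
    homogeneousComponent_of_mem (hhom _ _ (homogeneousComponent_isHomogeneous i p))
  simp_rw [h]
  rw [Finset.sum_ite_eq]
  split_ifs with hm
  · rfl
  · rw [homogeneousComponent_eq_zero, map_zero]
    simpa using hm

theorem HasHilbertBound.mem_adjoin_of_isHomogeneous [Finite G] {d : ℕ} (hG : HasHilbertBound G d)
    (φ : G →* (MvPolynomial (Fin n) ℂ →ₐ[ℂ] MvPolynomial (Fin n) ℂ))
    (hφ : ∀ g i, (φ g (X i)).IsHomogeneous 1) (m : ℕ) :
    ∀ f : MvPolynomial (Fin n) ℂ, f.IsHomogeneous m → (∀ g, φ g f = f) →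
      f ∈ Algebra.adjoin ℂ {f | (∀ g, φ g f = f) ∧ f.totalDegree ≤ d} := by
  classical
  have := Fintype.ofFinite G
  set S := Algebra.adjoin ℂ {f | (∀ g, φ g f = f) ∧ f.totalDegree ≤ d} with hS
  have hcomm := fun g => apply_homogeneousComponent_of_isHomogeneous (φ g) (hφ g)
  induction m using Nat.strong_induction_on with
  | _ m ih =>
  intro f hf hinv
  rcases le_or_gt m d with hmd | hmd
  · exact Algebra.subset_adjoin ⟨hinv, hf.totalDegree_le.trans hmd⟩
  let T : MvPolynomial (Fin n) ℂ →ₗ[ℂ] MvPolynomial (Fin n) ℂ :=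
    (∑ g : G, (φ g).toLinearMap) ∘ₗ homogeneousComponent m
  have hT : ∀ z, T z = ∑ g : G, φ g (homogeneousComponent m z) := fun z => by
    simp [T]
  let I := idealOfVars (Fin n) ℂ
  have hI : ∀ g, ∀ a ∈ I, φ g a ∈ I := by
    intro g
    change I ≤ I.comap (φ g)
    rw [Ideal.span_le]
    rintro _ ⟨i, rfl⟩
    have := (mem_pow_idealOfVars_iff' 1 (φ g (X i))).2 fun x hx =>
      (hφ g i).coeff_eq_zero (by omega)
    simpa [pow_one] using this
  have hI0 : ∀ a ∈ I, homogeneousComponent 0 a = 0 := by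
    intro a ha
    have h1 := (mem_pow_idealOfVars_iff' 1 a).1 (by simpa [pow_one] using ha) 0 (by simp)
    rw [homogeneousComponent_zero, h1, map_zero]
  have main : ∀ a ∈ I, (∀ g, φ g a = a) → ∀ b ∈ I, T (a * b) ∈ S := by
    intro a ha hainv b hb
    rw [← sum_homogeneousComponent a, ← sum_homogeneousComponent b, Finset.sum_mul_sum, map_sum]
    refine S.sum_mem fun j _ => ?_
    rw [map_sum]
    refine S.sum_mem fun k _ => ?_
    have h1 := homogeneousComponent_of_mem (m := m)
      ((homogeneousComponent_isHomogeneous j a).mul (homogeneousComponent_isHomogeneous k b))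
    rw [hT, h1]
    split_ifs with hjk
    · simp_rw [map_mul, hcomm _ j, hainv]
      rw [← Finset.mul_sum]
      rcases Nat.eq_zero_or_pos j with rfl | hj
      · rw [hI0 a ha, zero_mul]; exact S.zero_mem
      rcases Nat.eq_zero_or_pos k with rfl | hk
      · simp [hI0 b hb]
      refine S.mul_mem (ih j (by omega) _ (homogeneousComponent_isHomogeneous _ _) fun g => ?_)
        (ih k (by omega) _ ?_ fun g => ?_)
      · rw [hcomm, hainv]
      · refine IsHomogeneous.sum _ _ _ fun g _ => ?_
        rw [hcomm]
        exact homogeneousComponent_isHomogeneous _ _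
      · rw [map_sum]
        refine Fintype.sum_equiv (Equiv.mulLeft g) _ _ fun h => ?_
        rw [← map_mul_apply_of_action, Equiv.coe_mulLeft]
    · simp
  have h1 : f ∈ Ideal.span {a | a ∈ I ∧ ∀ g, φ g a = a} * I := by
    have h2 : f ∈ I ^ (d + 1) := (mem_pow_idealOfVars_iff' _ _).2 fun x hx =>
      hf.coeff_eq_zero (by omega)
    rw [pow_succ] at h2
    exact Ideal.mul_mono_left (hG _ φ I hI) h2
  have h2 : T f ∈ S := by
    refine Submodule.mul_induction_on h1 (fun x hx => ?_) fun x y hx hy => ?_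
    · refine Submodule.span_induction (p := fun x _ => ∀ y ∈ I, T (x * y) ∈ S)
        (fun x hx => main x hx.1 hx.2) ?_ ?_ ?_ hx
      · intro y _; rw [zero_mul, map_zero]; exact S.zero_mem
      · intro x y _ _ hx hy z hz
        rw [add_mul, map_add]
        exact S.add_mem (hx z hz) (hy z hz)
      · intro r x _ hx y hy
        rw [smul_eq_mul, mul_comm r, mul_assoc]
        exact hx _ (I.mul_mem_left r hy)
    · rw [map_add]; exact S.add_mem hx hy
  have h3 : T f = (Fintype.card G : ℂ) • f := by
    rw [hT]
    simp_rw [homogeneousComponent_eq_self hf, hinv]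
    simp [Nat.cast_smul_eq_nsmul]
  rw [h3] at h2
  have h4 := S.smul_mem h2 (Fintype.card G : ℂ)⁻¹
  rwa [inv_smul_smul₀ (Nat.cast_ne_zero.2 Fintype.card_ne_zero)] at h4

theorem Representation.polySubst_mul (ρ : Representation ℂ G (Fin n → ℂ)) (g h : G) :
    ρ.polySubst (h * g) = (ρ.polySubst g).comp (ρ.polySubst h) := by
  ext1 i
  simp only [Representation.polySubst, aeval_X, AlgHom.comp_apply, map_sum, map_mul,
    LinearMap.toMatrix'_mul, Matrix.mul_apply, algHom_C, Finset.sum_mul, Finset.mul_sum]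
  rw [Finset.sum_comm]
  simp [MvPolynomial.algebraMap_eq, mul_assoc]

theorem Representation.polySubst_one (ρ : Representation ℂ G (Fin n → ℂ)) :
    ρ.polySubst 1 = AlgHom.id ℂ _ := by
  ext1 i
  simp [Representation.polySubst, Pi.single_apply, apply_ite, ite_mul]

theorem HasHilbertBound.invariantsGeneratedInDegree [Finite G] {d : ℕ} (hG : HasHilbertBound G d)
    (ρ : Representation ℂ G (Fin n → ℂ)) : ρ.InvariantsGeneratedInDegree d := by
  let φ : G →* (MvPolynomial (Fin n) ℂ →ₐ[ℂ] MvPolynomial (Fin n) ℂ) :=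
    { toFun := fun g => ρ.polySubst g⁻¹
      map_one' := by rw [inv_one, ρ.polySubst_one]; rfl
      map_mul' := fun g h => by rw [mul_inv_rev, ρ.polySubst_mul]; rfl }
  have hφ : ∀ g i, (φ g (X i)).IsHomogeneous 1 := fun g i => by
    change (ρ.polySubst g⁻¹ (X i)).IsHomogeneous 1
    rw [Representation.polySubst, aeval_X]
    exact IsHomogeneous.sum _ _ _ fun j _ => isHomogeneous_C_mul_X _ _
  have hmem : ∀ f, f ∈ ρ.invariantAlgebra ↔ ∀ g, φ g f = f := by
    intro f
    simp only [Representation.invariantAlgebra, Algebra.mem_iInf, AlgHom.mem_equalizer]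
    exact ⟨fun h g => h g⁻¹, fun h g => by simpa [φ] using h g⁻¹⟩
  unfold Representation.InvariantsGeneratedInDegree
  apply le_antisymm
  · exact Algebra.adjoin_le fun f hf => hf.1
  · intro f hf
    simp only [hmem] at hf ⊢
    rw [← sum_homogeneousComponent f]
    refine Subalgebra.sum_mem _ fun m _ => ?_
    refine hG.mem_adjoin_of_isHomogeneous φ hφ m _ (homogeneousComponent_isHomogeneous m f)
      fun g => ?_
    rw [apply_homogeneousComponent_of_isHomogeneous _ (hφ g), hf]

theorem noetherNumber_le_of_hasHilbertBound [Finite G] {d : ℕ} (hG : HasHilbertBound G d) :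
    noetherNumber G ≤ d :=
  Nat.sInf_le fun _ ρ => hG.invariantsGeneratedInDegree ρ

end Polynomial


section Weights

open ZMod

variable {p : ℕ} [NeZero p] {A : Type}

theorem exists_sum_eigenvectors [AddCommGroup A] [Module ℂ A] (ν : A →ₗ[ℂ] A) (hν : ν ^ p = 1)
    (V : Submodule ℂ A) (hV : ∀ a ∈ V, ν a ∈ V) {x : A} (hx : x ∈ V) :
    ∃ e : ZMod p → A, (∀ k, e k ∈ V ∧ ν (e k) = stdAddChar k • e k) ∧ ∑ k, e k = x := by
  have hpow : ∀ m, (ν ^ m) x ∈ V := fun m => by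
    induction m with
    | zero => simpa using hx
    | succ m ih => rw [pow_succ']; exact hV _ ih
  have hval : ∀ j : ZMod p, ν ^ (j + 1).val = ν ^ (j.val + 1) := fun j => by
    rw [ZMod.val_add, ← pow_eq_pow_mod _ hν, pow_add, pow_add, ZMod.val_one_eq_one_mod,
      ← pow_eq_pow_mod _ hν]
  refine ⟨fun k => (p : ℂ)⁻¹ • ∑ j : ZMod p, stdAddChar (-(k * j)) • (ν ^ j.val) x,
    fun k => ⟨V.smul_mem _ (V.sum_mem fun j _ => V.smul_mem _ (hpow _)), ?_⟩, ?_⟩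
  · rw [_root_.map_smul, smul_comm]
    congr 1
    rw [map_sum, Finset.smul_sum]
    refine Fintype.sum_equiv (Equiv.addRight 1) _ _ fun j => ?_
    rw [_root_.map_smul, Equiv.coe_addRight, hval, smul_smul, ← AddChar.map_add_eq_mul, pow_succ']
    congr 2
    ring
  · rw [← Finset.smul_sum, Finset.sum_comm]
    have h : ∀ j : ZMod p, ∑ k : ZMod p, (stdAddChar (-(k * j)) : ℂ) • (ν ^ j.val) x =
        if j = 0 then (p : ℂ) • x else 0 := fun j => by
      rw [← Finset.sum_smul]
      have h1 := AddChar.sum_mulShift (-j) (isPrimitive_stdAddChar p)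
      simp only [mul_neg, neg_eq_zero] at h1
      rw [h1]
      split_ifs with h0
      · subst h0; simp
      · simp
    simp_rw [h]
    rw [Finset.sum_ite_eq' , if_pos (Finset.mem_univ _), inv_smul_smul₀]
    exact Nat.cast_ne_zero.2 (NeZero.ne p)

end Weights

section WeightVectors

open ZMod

variable {p : ℕ} [NeZero p] {A : Type} [CommRing A] [Algebra ℂ A] (ν : A →ₐ[ℂ] A)

/-- `a` is a weight vector of weight `k` for the endomorphism `ν` of order `p`. -/
def IsWeightVector (k : ZMod p) (a : A) : Prop := ν a = (stdAddChar k : ℂ) • a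

variable {ν}

theorem IsWeightVector.mul {k l : ZMod p} {a b : A} (ha : IsWeightVector ν k a)
    (hb : IsWeightVector ν l b) : IsWeightVector ν (k + l) (a * b) := by
  rw [IsWeightVector, map_mul, ha, hb, smul_mul_smul_comm, AddChar.map_add_eq_mul]

theorem IsWeightVector.prod {ι : Type*} (s : Finset ι) {w : ι → ZMod p} {x : ι → A}
    (h : ∀ i ∈ s, IsWeightVector ν (w i) (x i)) :
    IsWeightVector ν (∑ i ∈ s, w i) (∏ i ∈ s, x i) := by
  classical
  induction s using Finset.induction_on with
  | empty => simp [IsWeightVector]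
  | insert i s hi ih =>
    rw [Finset.sum_insert hi, Finset.prod_insert hi]
    exact (h i (Finset.mem_insert_self i s)).mul (ih fun j hj => h j (Finset.mem_insert_of_mem hj))

theorem isWeightVector_zero_iff {a : A} : IsWeightVector ν (0 : ZMod p) a ↔ ν a = a := by
  simp [IsWeightVector]

theorem le_span_weightVectors (hν : ν.toLinearMap ^ p = 1) (I : Ideal A)
    (hI : ∀ a ∈ I, ν a ∈ I) :
    I ≤ Ideal.span {a | a ∈ I ∧ ∃ k : ZMod p, IsWeightVector ν k a} := by
  intro x hx
  obtain ⟨e, he, rfl⟩ := exists_sum_eigenvectors ν.toLinearMap hν (I.restrictScalars ℂ) hI hx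
  exact Ideal.sum_mem _ fun k _ => Ideal.subset_span ⟨(he k).1, k, (he k).2⟩

theorem le_span_weightVectors₂ {μ : A →ₐ[ℂ] A} (hν : ν.toLinearMap ^ p = 1)
    (hμ : μ.toLinearMap ^ p = 1) (hcomm : ∀ a, μ (ν a) = ν (μ a)) (I : Ideal A)
    (hI : ∀ a ∈ I, ν a ∈ I) (hI' : ∀ a ∈ I, μ a ∈ I) :
    I ≤ Ideal.span {a | a ∈ I ∧ ∃ k l : ZMod p, IsWeightVector ν k a ∧ IsWeightVector μ l a} := by
  intro x hx
  obtain ⟨e, he, rfl⟩ := exists_sum_eigenvectors ν.toLinearMap hν (I.restrictScalars ℂ) hI hx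
  refine Ideal.sum_mem _ fun k _ => ?_
  obtain ⟨f, hf, hf'⟩ := exists_sum_eigenvectors μ.toLinearMap hμ
    (I.restrictScalars ℂ ⊓ LinearMap.eqLocus ν.toLinearMap ((stdAddChar k : ℂ) • LinearMap.id))
    (fun a ha => ⟨hI' a ha.1, (hcomm a).symm.trans
      ((congrArg μ ha.2).trans (_root_.map_smul μ _ a))⟩) (he k)
  rw [← hf']
  exact Ideal.sum_mem _ fun l _ => Ideal.subset_span ⟨(hf l).1.1, k, l, (hf l).1.2, (hf l).2⟩

end WeightVectors


section ZeroSum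

open Finset
open scoped Pointwise

variable {p : ℕ} {ι : Type}

/-- The set of all sums of `w` over subsets of `T`. -/
def subsetSums (w : ι → ZMod p) (T : Finset ι) : Finset (ZMod p) :=
  T.powerset.image fun S => ∑ i ∈ S, w i

variable {w : ι → ZMod p} {S T U : Finset ι}

theorem mem_subsetSums {a : ZMod p} : a ∈ subsetSums w T ↔ ∃ S ⊆ T, ∑ i ∈ S, w i = a := by
  simp [subsetSums]

theorem subsetSums_nonempty : (subsetSums w T).Nonempty :=
  ⟨0, mem_subsetSums.2 ⟨∅, empty_subset _, sum_empty⟩⟩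

theorem mem_subsetSums_of_le_card [Fact p.Prime] (h : p ≤ #(subsetSums w T)) (a : ZMod p) :
    a ∈ subsetSums w T := by
  rw [eq_univ_of_card (subsetSums w T) (le_antisymm (card_le_univ _) (by rwa [ZMod.card]))]
  exact mem_univ a

variable [DecidableEq ι]

theorem min_le_card_subsetSums_union (hp : p.Prime) {a b : ℕ} (h : Disjoint S T)
    (hS : min p (1 + a) ≤ #(subsetSums w S)) (hT : min p (1 + b) ≤ #(subsetSums w T)) :
    min p (1 + (a + b)) ≤ #(subsetSums w (S ∪ T)) := by
  have h1 := ZMod.cauchy_davenport hp (subsetSums_nonempty (w := w) (T := S))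
    (subsetSums_nonempty (w := w) (T := T))
  have h2 : subsetSums w S + subsetSums w T ⊆ subsetSums w (S ∪ T) := by
    intro x hx
    obtain ⟨y, hy, z, hz, rfl⟩ := mem_add.1 hx
    obtain ⟨S', hS', rfl⟩ := mem_subsetSums.1 hy
    obtain ⟨T', hT', rfl⟩ := mem_subsetSums.1 hz
    refine mem_subsetSums.2 ⟨S' ∪ T', union_subset_union hS' hT', ?_⟩
    exact sum_union (disjoint_of_subset_left hS' (disjoint_of_subset_right hT' h))
  have h3 := card_le_card h2
  omega

theorem min_le_card_subsetSums (hp : p.Prime) (hw : ∀ i ∈ T, w i ≠ 0) :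
    min p (1 + #T) ≤ #(subsetSums w T) := by
  induction T using Finset.induction_on with
  | empty => simpa using Or.inr (subsetSums_nonempty (w := w) (T := ∅)).card_pos
  | insert i T hi ih =>
    rw [card_insert_of_notMem hi, insert_eq, add_comm #T 1]
    refine min_le_card_subsetSums_union hp (disjoint_singleton_left.2 hi) ?_
      (ih fun j hj => hw j (mem_insert_of_mem hj))
    refine (min_le_right _ _).trans ?_
    have h2 : #({w i, 0} : Finset (ZMod p)) = 1 + 1 := card_pair (hw i (mem_insert_self _ _))
    rw [← h2]
    refine card_le_card fun a ha => ?_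
    rcases mem_insert.1 ha with rfl | ha
    · exact mem_subsetSums.2 ⟨{i}, Subset.rfl, sum_singleton _ _⟩
    · rw [mem_singleton.1 ha]
      exact mem_subsetSums.2 ⟨∅, empty_subset _, sum_empty⟩

theorem exists_sum_eq [Fact p.Prime] (hw : ∀ i ∈ T, w i ≠ 0) (hT : p ≤ #T + 1) (a : ZMod p) :
    ∃ S ⊆ T, ∑ i ∈ S, w i = a := by
  have := min_le_card_subsetSums Fact.out hw
  exact mem_subsetSums.1 (mem_subsetSums_of_le_card (by omega) a)

theorem exists_zero_sum_of_le_card_subsetSums [Fact p.Prime] {x : ι} (hx : x ∈ T)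
    (h : p ≤ #(subsetSums w (T.erase x))) : ∃ S ⊆ T, S.Nonempty ∧ ∑ i ∈ S, w i = 0 := by
  obtain ⟨S, hS, hS'⟩ := mem_subsetSums.1 (mem_subsetSums_of_le_card h (-w x))
  have hxS : x ∉ S := fun h => notMem_erase x T (hS h)
  refine ⟨insert x S, insert_subset hx (hS.trans (erase_subset _ _)), insert_nonempty _ _, ?_⟩
  rw [sum_insert hxS, hS', add_neg_cancel]

theorem exists_zero_sum [Fact p.Prime] (hT : p ≤ #T) :
    ∃ S ⊆ T, S.Nonempty ∧ ∑ i ∈ S, w i = 0 := by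
  by_cases h0 : ∃ i ∈ T, w i = 0
  · obtain ⟨i, hi, h⟩ := h0
    exact ⟨{i}, singleton_subset_iff.2 hi, singleton_nonempty i, by simpa⟩
  push Not at h0
  have hp : p.Prime := Fact.out
  obtain ⟨x, hx⟩ : T.Nonempty := card_pos.1 (hp.pos.trans_le hT)
  refine exists_zero_sum_of_le_card_subsetSums hx ?_
  have := min_le_card_subsetSums (T := T.erase x) hp fun i hi => h0 i (mem_of_mem_erase hi)
  rw [card_erase_of_mem hx] at this
  omega

/-- `T` contains `k` disjoint nonempty subsets of zero sum. -/
def HasZeroSums (w : ι → ZMod p) : ℕ → Finset ι → Prop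
  | 0, _ => True
  | k + 1, T => ∃ S ⊆ T, S.Nonempty ∧ ∑ i ∈ S, w i = 0 ∧ HasZeroSums w k (T \ S)

theorem HasZeroSums.mono {k : ℕ} (h : HasZeroSums w k T) (hTU : T ⊆ U) : HasZeroSums w k U := by
  induction k generalizing T U with
  | zero => trivial
  | succ k ih =>
    obtain ⟨S, hS, hne, h0, h⟩ := h
    exact ⟨S, hS.trans hTU, hne, h0, ih h (sdiff_subset_sdiff hTU Subset.rfl)⟩

theorem HasZeroSums.union {k l : ℕ} (h : HasZeroSums w k T) (h' : HasZeroSums w l U)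
    (hTU : Disjoint T U) : HasZeroSums w (k + l) (T ∪ U) := by
  induction k generalizing T with
  | zero => rw [zero_add]; exact h'.mono subset_union_right
  | succ k ih =>
    obtain ⟨S, hS, hne, h0, h⟩ := h
    rw [Nat.add_right_comm]
    refine ⟨S, hS.trans subset_union_left, hne, h0, ?_⟩
    rw [union_sdiff_distrib, sdiff_eq_self_of_disjoint (disjoint_of_subset_left hS hTU).symm]
    exact ih h (disjoint_of_subset_left sdiff_subset hTU)

theorem HasZeroSums.add_one {k : ℕ} (h : HasZeroSums w k (T \ S)) (hST : S ⊆ T)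
    (hS : S.Nonempty) (h0 : ∑ i ∈ S, w i = 0) : HasZeroSums w (k + 1) T :=
  ⟨S, hST, hS, h0, h⟩

theorem hasZeroSums_of_mul_le_card [Fact p.Prime] {k : ℕ} (h : k * p ≤ #T) :
    HasZeroSums w k T := by
  induction k generalizing T with
  | zero => trivial
  | succ k ih =>
    rw [Nat.succ_mul] at h
    obtain ⟨T', hT', hc⟩ := exists_subset_card_eq (n := p) (s := T) (by omega)
    obtain ⟨S, hS, hne, h0⟩ := exists_zero_sum (w := w) hc.ge
    refine ⟨S, hS.trans hT', hne, h0, ih ?_⟩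
    have := card_le_card hS
    rw [card_sdiff_of_subset (hS.trans hT')]
    omega

theorem hasZeroSums_of_eq_zero {k : ℕ} (hk : k ≤ #T) (h : ∀ i ∈ T, w i = 0) :
    HasZeroSums w k T := by
  induction k generalizing T with
  | zero => trivial
  | succ k ih =>
    obtain ⟨i, hi⟩ : T.Nonempty := card_pos.1 (by omega)
    refine ⟨{i}, singleton_subset_iff.2 hi, singleton_nonempty i, by simpa using h i hi,
      ih ?_ fun j hj => h j (sdiff_subset hj)⟩
    rw [card_sdiff_of_subset (singleton_subset_iff.2 hi), card_singleton]
    omega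

/-- `T` contains `k` disjoint pairs of elements of different weights. -/
def HasPairs (w : ι → ZMod p) : ℕ → Finset ι → Prop
  | 0, _ => True
  | k + 1, T => ∃ i ∈ T, ∃ j ∈ T, w i ≠ w j ∧ HasPairs w k (T \ {i, j})

theorem HasPairs.mono {k : ℕ} (h : HasPairs w k T) (hTU : T ⊆ U) : HasPairs w k U := by
  induction k generalizing T U with
  | zero => trivial
  | succ k ih =>
    obtain ⟨i, hi, j, hj, hij, h⟩ := h
    exact ⟨i, hTU hi, j, hTU hj, hij, ih h (sdiff_subset_sdiff hTU Subset.rfl)⟩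

theorem HasPairs.congr {w' : ι → ZMod p} {k : ℕ} (h : HasPairs w k T)
    (hw : ∀ i ∈ T, w' i = w i) : HasPairs w' k T := by
  induction k generalizing T with
  | zero => trivial
  | succ k ih =>
    obtain ⟨i, hi, j, hj, hij, h⟩ := h
    exact ⟨i, hi, j, hj, by rwa [hw i hi, hw j hj], ih h fun x hx => hw x (sdiff_subset hx)⟩

theorem HasPairs.union {k l : ℕ} (h : HasPairs w k T) (h' : HasPairs w l U)
    (hTU : Disjoint T U) : HasPairs w (k + l) (T ∪ U) := by
  induction k generalizing T with
  | zero => rw [zero_add]; exact h'.mono subset_union_right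
  | succ k ih =>
    obtain ⟨i, hi, j, hj, hij, h⟩ := h
    rw [Nat.add_right_comm]
    refine ⟨i, mem_union_left _ hi, j, mem_union_left _ hj, hij, ?_⟩
    have hS : {i, j} ⊆ T := insert_subset hi (singleton_subset_iff.2 hj)
    rw [union_sdiff_distrib, sdiff_eq_self_of_disjoint (disjoint_of_subset_left hS hTU).symm]
    exact ih h (disjoint_of_subset_left sdiff_subset hTU)

theorem HasPairs.exists_subset {k l : ℕ} (h : HasPairs w (k + l) T) :
    ∃ P ⊆ T, #P = 2 * k ∧ HasPairs w k P ∧ HasPairs w l (T \ P) := by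
  induction k generalizing T with
  | zero => exact ⟨∅, empty_subset _, rfl, trivial, by simpa using h⟩
  | succ k ih =>
    rw [Nat.add_right_comm] at h
    obtain ⟨i, hi, j, hj, hij, h⟩ := h
    obtain ⟨P, hP, hc, h1, h2⟩ := ih h
    have hd : Disjoint P {i, j} := disjoint_of_subset_left hP sdiff_disjoint
    have hne : i ≠ j := fun h => hij (congrArg w h)
    refine ⟨P ∪ {i, j}, union_subset (hP.trans sdiff_subset)
      (insert_subset hi (singleton_subset_iff.2 hj)), ?_, ?_, ?_⟩
    · rw [card_union_of_disjoint hd, card_pair hne]; omega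
    · refine h1.union (l := 1) ⟨i, ?_, j, ?_, hij, trivial⟩ hd <;> simp
    · rwa [union_comm, ← sup_eq_union, ← sdiff_sdiff_left]

theorem hasPairs_or_exists_constant (w : ι → ZMod p) (m : ℕ) (T : Finset ι) :
    HasPairs w m T ∨ ∃ k < m, ∃ P ⊆ T, #P = 2 * k ∧ HasPairs w k P ∧
      ∃ a, ∀ i ∈ T \ P, w i = a := by
  induction m generalizing T with
  | zero => exact Or.inl trivial
  | succ m ih =>
    by_cases h : ∃ i ∈ T, ∃ j ∈ T, w i ≠ w j
    · obtain ⟨i, hi, j, hj, hij⟩ := h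
      rcases ih (T \ {i, j}) with h | ⟨k, hk, P, hP, hc, h1, a, ha⟩
      · exact Or.inl ⟨i, hi, j, hj, hij, h⟩
      · have hd : Disjoint P {i, j} := disjoint_of_subset_left hP sdiff_disjoint
        have hne : i ≠ j := fun h => hij (congrArg w h)
        refine Or.inr ⟨k + 1, by omega, P ∪ {i, j}, union_subset (hP.trans sdiff_subset)
          (insert_subset hi (singleton_subset_iff.2 hj)), ?_, ?_, a, ?_⟩
        · rw [card_union_of_disjoint hd, card_pair hne]; omega
        · refine h1.union (l := 1) ⟨i, ?_, j, ?_, hij, trivial⟩ hd <;> simp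
        · rwa [union_comm, ← sup_eq_union, ← sdiff_sdiff_left]
    · push Not at h
      refine Or.inr ⟨0, by omega, ∅, empty_subset _, rfl, trivial, ?_⟩
      rcases T.eq_empty_or_nonempty with rfl | ⟨x, hx⟩
      · exact ⟨0, by simp⟩
      · exact ⟨w x, fun i hi => h i (sdiff_subset hi) x hx⟩

theorem hasPairs_union_of_ne {k : ℕ} (hS : k ≤ #S) (hT : k ≤ #T)
    (h : ∀ i ∈ S, ∀ j ∈ T, w i ≠ w j) : HasPairs w k (S ∪ T) := by
  induction k generalizing S T with
  | zero => trivial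
  | succ k ih =>
    obtain ⟨i, hi⟩ : S.Nonempty := card_pos.1 (by omega)
    obtain ⟨j, hj⟩ : T.Nonempty := card_pos.1 (by omega)
    refine ⟨i, mem_union_left _ hi, j, mem_union_right _ hj, h i hi j hj,
      (ih (S := S.erase i) (T := T.erase j) (by rw [card_erase_of_mem hi]; omega)
        (by rw [card_erase_of_mem hj]; omega)
        fun a ha b hb => h a (mem_of_mem_erase ha) b (mem_of_mem_erase hb)).mono ?_⟩
    intro x hx
    have hdis : ∀ y, y ∈ S → y ∉ T := fun y hy hy' => h y hy y hy' rfl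
    have := hdis i hi
    have := hdis x
    simp only [mem_union, mem_erase, mem_sdiff, mem_insert, mem_singleton] at hx ⊢
    grind

theorem HasPairs.min_le_card_subsetSums [Fact p.Prime] {k : ℕ} (h : HasPairs w k T)
    (hT : ¬∃ S ⊆ T, S.Nonempty ∧ ∑ i ∈ S, w i = 0) :
    min p (1 + (#T + k)) ≤ #(subsetSums w T) := by
  have hp : p.Prime := Fact.out
  have hne : ∀ i ∈ T, w i ≠ 0 := fun i hi h0 =>
    hT ⟨{i}, singleton_subset_iff.2 hi, singleton_nonempty i, by simpa⟩
  induction k generalizing T with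
  | zero => exact _root_.min_le_card_subsetSums hp hne
  | succ k ih =>
    obtain ⟨i, hi, j, hj, hij, h⟩ := h
    have hne' : i ≠ j := fun h => hij (congrArg w h)
    have hS : {i, j} ⊆ T := insert_subset hi (singleton_subset_iff.2 hj)
    have h1 := ih h (fun ⟨S, hS, h⟩ => hT ⟨S, hS.trans sdiff_subset, h⟩)
      fun x hx => hne x (sdiff_subset hx)
    have h2 : min p (1 + 3) ≤ #(subsetSums w {i, j}) := by
      refine (min_le_right _ _).trans ?_
      have h3 : #({0, w i, w j, w i + w j} : Finset (ZMod p)) = 1 + 3 := by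
        have hi0 := hne i hi
        have hj0 := hne j hj
        have hs0 : w i + w j ≠ 0 := fun h0 =>
          hT ⟨{i, j}, hS, insert_nonempty _ _, by rwa [sum_pair hne']⟩
        rw [card_insert_of_notMem, card_insert_of_notMem, card_pair]
        · simpa using hi0
        · simp [hij, hj0]
        · simp [hi0.symm, hj0.symm, hs0.symm]
      rw [← h3]
      refine card_le_card fun a ha => ?_
      simp only [mem_insert, mem_singleton] at ha
      rcases ha with rfl | rfl | rfl | rfl
      · exact mem_subsetSums.2 ⟨∅, empty_subset _, sum_empty⟩
      · exact mem_subsetSums.2 ⟨{i}, by simp, sum_singleton _ _⟩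
      · exact mem_subsetSums.2 ⟨{j}, by simp, sum_singleton _ _⟩
      · exact mem_subsetSums.2 ⟨{i, j}, Subset.rfl, sum_pair hne'⟩
    have h4 := min_le_card_subsetSums_union hp sdiff_disjoint h1 h2
    rw [sdiff_union_of_subset hS, card_sdiff_of_subset hS, card_pair hne'] at h4
    have h5 := card_le_card hS
    rw [card_pair hne'] at h5
    refine le_trans ?_ h4
    refine min_le_min le_rfl ?_
    omega

theorem HasPairs.exists_zero_sum [Fact p.Prime] {k : ℕ} (h : HasPairs w k T) (hk : 2 * k < #T)
    (hp : p ≤ #T + k) : ∃ S ⊆ T, S.Nonempty ∧ ∑ i ∈ S, w i = 0 := by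
  by_contra hcon
  obtain ⟨P, hPT, hPc, hP, -⟩ := HasPairs.exists_subset (l := 0) h
  obtain ⟨x, hx, hxP⟩ := exists_mem_notMem_of_card_lt_card (hPc.trans_lt hk)
  refine hcon (exists_zero_sum_of_le_card_subsetSums hx ?_)
  have h1 := (hP.mono (subset_erase.2 ⟨hPT, hxP⟩)).min_le_card_subsetSums
    fun ⟨S, hS, h⟩ => hcon ⟨S, hS.trans (erase_subset _ _), h⟩
  rw [card_erase_of_mem hx] at h1
  omega

theorem HasPairs.hasZeroSums [Fact p.Prime] {q k s : ℕ} (h : HasPairs w (q * k) T)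
    (hT : q * s ≤ #T) (hk : 2 * k < s) (hp : p ≤ s + k) : HasZeroSums w q T := by
  induction q generalizing T with
  | zero => trivial
  | succ q ih =>
    rw [Nat.succ_mul, add_comm] at h
    rw [Nat.succ_mul] at hT
    obtain ⟨P, hPT, hPc, hP, h⟩ := h.exists_subset
    obtain ⟨P', hPT', hPc', hP', -⟩ := HasPairs.exists_subset (k := q * k) (l := 0) h
    have hqk : q * (2 * k) ≤ q * s := Nat.mul_le_mul_left q hk.le
    have hqk' : q * (2 * k) = 2 * (q * k) := by ring
    have hPle := card_le_card hPT
    have hP'le := card_le_card hPT'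
    obtain ⟨R, hR, hRc⟩ := exists_subset_card_eq (s := (T \ P) \ P') (n := s - 2 * k) (by
      rw [card_sdiff_of_subset hPT']
      rw [card_sdiff_of_subset hPT] at hP'le ⊢
      omega)
    have hRT : R ⊆ T := hR.trans (sdiff_subset.trans sdiff_subset)
    have hPR : Disjoint P R := disjoint_of_subset_right (hR.trans sdiff_subset) disjoint_sdiff
    have hc : #(P ∪ R) = s := by rw [card_union_of_disjoint hPR]; omega
    obtain ⟨S, hS, hne, h0⟩ := (hP.mono subset_union_left).exists_zero_sum (T := P ∪ R)
      (by omega) (by omega)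
    refine HasZeroSums.add_one (HasZeroSums.mono (ih (T := T \ (P ∪ R)) (hP'.mono ?_) ?_)
      (sdiff_subset_sdiff Subset.rfl hS)) (hS.trans (union_subset hPT hRT)) hne h0
    · rw [← sup_eq_union, ← sdiff_sdiff_left]
      refine subset_sdiff.2 ⟨hPT', ?_⟩
      exact disjoint_of_subset_right hR disjoint_sdiff
    · rw [card_sdiff_of_subset (union_subset hPT hRT), hc]
      omega

end ZeroSum


section Swapping

open Finset

variable {p : ℕ} [NeZero p] {A : Type} [CommRing A] [Algebra ℂ A]

/-- The data on an ideal `J` coming from an action of a semidirect product of a group of order `p`,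
generated by `ν`, with a group of order `q`, generated by `γ`. -/
structure IsMetacyclicIdeal (q : ℕ) (r : ZMod p) (ν γ : A →ₐ[ℂ] A) (I J : Ideal A) : Prop where
  map_mem : ∀ a ∈ I, γ a ∈ I
  weight : ∀ (k : ZMod p) (a : A), IsWeightVector ν k a → IsWeightVector ν (r * k) (γ a)
  sum_mem : ∀ u ∈ I, ν u = u → ∀ v, ∑ j ∈ range q, (γ ^ j) u * v ∈ J
  pow_le : Ideal.span {a | a ∈ I ∧ ν a = a} ^ q ≤ J
  pow_eq : γ ^ q = 1

/-- All products of weight vectors in `I` with weights `w` belong to `J`. -/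
def IsGood {ι : Type} [Fintype ι] (ν : A →ₐ[ℂ] A) (I J : Ideal A) (w : ι → ZMod p) : Prop :=
  ∀ x : ι → A, (∀ i, x i ∈ I ∧ IsWeightVector ν (w i) (x i)) → ∏ i, x i ∈ J

variable {q : ℕ} {r : ZMod p} {ν γ : A →ₐ[ℂ] A} {I J : Ideal A} {ι : Type}
  {w : ι → ZMod p} {S T : Finset ι}

omit [Algebra ℂ A] in
theorem prod_mem_of_nonempty {x : ι → A} (hx : ∀ i, x i ∈ I) (hS : S.Nonempty) :
    ∏ i ∈ S, x i ∈ I := by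
  obtain ⟨i, hi⟩ := hS
  exact I.mem_of_dvd (dvd_prod_of_mem _ hi) (hx i)

theorem prod_invariant_of_sum_eq_zero {x : ι → A} (hx : ∀ i, IsWeightVector ν (w i) (x i))
    (hS : ∑ i ∈ S, w i = 0) : ν (∏ i ∈ S, x i) = ∏ i ∈ S, x i := by
  have := IsWeightVector.prod S fun i _ => hx i
  rwa [hS, isWeightVector_zero_iff] at this

variable [DecidableEq ι]

theorem HasZeroSums.prod_mem {k : ℕ} (h : HasZeroSums w k T) {x : ι → A}
    (hx : ∀ i, x i ∈ I ∧ IsWeightVector ν (w i) (x i)) :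
    ∏ i ∈ T, x i ∈ Ideal.span {a | a ∈ I ∧ ν a = a} ^ k := by
  induction k generalizing T with
  | zero => simp
  | succ k ih =>
    obtain ⟨S, hST, hS, h0, h⟩ := h
    rw [← prod_sdiff hST, pow_succ]
    exact Ideal.mul_mem_mul (ih h) (Ideal.subset_span ⟨prod_mem_of_nonempty (fun i => (hx i).1) hS,
      prod_invariant_of_sum_eq_zero (fun i => (hx i).2) h0⟩)

namespace IsMetacyclicIdeal

theorem pow_apply_mem (h : IsMetacyclicIdeal q r ν γ I J) (j : ℕ) {a : A} (ha : a ∈ I) :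
    (γ ^ j) a ∈ I := by
  induction j with
  | zero => simpa
  | succ j ih => rw [pow_succ']; exact h.map_mem _ ih

theorem weight_pow (h : IsMetacyclicIdeal q r ν γ I J) (j : ℕ) {k : ZMod p} {a : A}
    (ha : IsWeightVector ν k a) : IsWeightVector ν (r ^ j * k) ((γ ^ j) a) := by
  induction j with
  | zero => simpa
  | succ j ih => rw [pow_succ', pow_succ', mul_assoc]; exact h.weight _ _ ih

variable [Fintype ι]

theorem isGood_of_hasZeroSums (h : IsMetacyclicIdeal q r ν γ I J)
    (hw : HasZeroSums w q univ) : IsGood ν I J w :=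
  fun _ hx => h.pow_le (hw.prod_mem hx)

theorem isGood_of_forall_isGood (h : IsMetacyclicIdeal q r ν γ I J) (hq : 0 < q)
    (hS : S.Nonempty) (h0 : ∑ i ∈ S, w i = 0)
    (hw : ∀ j, 0 < j → j < q → IsGood ν I J fun i => if i ∈ S then r ^ j * w i else w i) :
    IsGood ν I J w := by
  intro x hx
  have h1 := h.sum_mem _ (prod_mem_of_nonempty (fun i => (hx i).1) hS)
    (prod_invariant_of_sum_eq_zero (fun i => (hx i).2) h0) (∏ i ∈ univ \ S, x i)
  have h2 : ∑ j ∈ (range q).erase 0, (γ ^ j) (∏ i ∈ S, x i) * ∏ i ∈ univ \ S, x i ∈ J := by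
    refine J.sum_mem fun j hj => ?_
    rw [mem_erase, mem_range] at hj
    have h3 := hw j (Nat.pos_of_ne_zero hj.1) hj.2 (fun i => if i ∈ S then (γ ^ j) (x i) else x i)
      fun i => by
        dsimp only
        split_ifs
        · exact ⟨h.pow_apply_mem j (hx i).1, h.weight_pow j (hx i).2⟩
        · exact hx i
    rw [← prod_sdiff (subset_univ S), mul_comm] at h3
    rw [map_prod]
    convert h3 using 2
    · exact prod_congr rfl fun i hi => by rw [if_pos hi]
    · exact prod_congr rfl fun i hi => by rw [if_neg (mem_sdiff.1 hi).2]
  rw [← add_sum_erase _ _ (mem_range.2 hq), J.add_mem_iff_left h2, pow_zero, AlgHom.one_apply,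
    mul_comm, prod_sdiff (subset_univ S)] at h1
  exact h1

theorem isGood_of_isGood_three (h : IsMetacyclicIdeal 3 r ν γ I J) (hST : Disjoint S T)
    (hS : S.Nonempty) (hT : T.Nonempty) (hS0 : ∑ i ∈ S, w i = 0) (hT0 : ∑ i ∈ T, w i = 0)
    (hw : IsGood ν I J fun i => if i ∈ S then r * w i else if i ∈ T then r ^ 2 * w i else w i) :
    IsGood ν I J w := by
  intro x hx
  have hγ : ∀ a, γ (γ (γ a)) = a := fun a => by
    have := DFunLike.congr_fun h.pow_eq a
    simpa [pow_succ] using this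
  have hν : ∀ a, ν a = a → ν (γ a) = γ a := fun a ha => by
    have := h.weight 0 a (isWeightVector_zero_iff.2 ha)
    rwa [mul_zero, isWeightVector_zero_iff] at this
  have key : ∀ u ∈ I, ν u = u → ∀ v, u * v + γ u * v + γ (γ u) * v ∈ J := fun u hu hu' v => by
    simpa [sum_range_succ, pow_succ] using h.sum_mem u hu hu' v
  have hprod : ∏ i, x i = (∏ i ∈ S, x i) * (∏ i ∈ T, x i) * ∏ i ∈ univ \ (S ∪ T), x i := by
    rw [← prod_union hST, mul_comm, prod_sdiff (subset_univ _)]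
  have hs := prod_mem_of_nonempty (fun i => (hx i).1) hS
  have hs' := prod_invariant_of_sum_eq_zero (fun i => (hx i).2) hS0
  have ht := prod_mem_of_nonempty (fun i => (hx i).1) hT
  have ht' := prod_invariant_of_sum_eq_zero (fun i => (hx i).2) hT0
  have hgood : γ (∏ i ∈ S, x i) * γ (γ (∏ i ∈ T, x i)) * ∏ i ∈ univ \ (S ∪ T), x i ∈ J := by
    have h3 := hw (fun i => if i ∈ S then γ (x i) else if i ∈ T then γ (γ (x i)) else x i)
      fun i => by
        dsimp only
        split_ifs
        · exact ⟨h.map_mem _ (hx i).1, h.weight _ _ (hx i).2⟩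
        · rw [pow_two, mul_assoc]
          exact ⟨h.map_mem _ (h.map_mem _ (hx i).1), h.weight _ _ (h.weight _ _ (hx i).2)⟩
        · exact hx i
    rw [← prod_sdiff (subset_univ (S ∪ T)), prod_union hST, mul_comm] at h3
    simp only [map_prod]
    convert h3 using 3
    · exact prod_congr rfl fun i hi => by rw [if_pos hi]
    · exact prod_congr rfl fun i hi => by
        rw [if_neg (disjoint_right.1 hST hi), if_pos hi]
    · rename_i i hi
      have := (mem_sdiff.1 hi).2
      rw [mem_union, not_or] at this
      rw [if_neg this.1, if_neg this.2]
  rw [hprod]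
  generalize (∏ i ∈ S, x i) = u at *
  generalize (∏ i ∈ T, x i) = v at *
  generalize (∏ i ∈ univ \ (S ∪ T), x i) = z at *
  refine Ideal.mem_of_natCast_mul_mem (n := 3) (by norm_num) ?_
  have e1 := key u hs hs' (v * z)
  have e2 := key v ht ht' (u * z)
  have e3 := key (u * v) (I.mul_mem_right _ hs) (by rw [map_mul, hs', ht']) z
  have e4 := key u hs hs' (γ (γ v) * z)
  have e5 := key v ht ht' (γ u * z)
  have e6 := key (u * γ v) (I.mul_mem_right _ hs) (by rw [map_mul, hs', hν v ht']) z
  convert J.add_mem (J.sub_mem (J.add_mem (J.add_mem e1 e2) e3)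
    (J.add_mem (J.add_mem e4 e5) e6)) (J.mul_mem_left 3 hgood) using 1
  simp only [map_mul, hγ]
  push_cast
  ring

theorem isGood_of_isGood_two (h : IsMetacyclicIdeal 2 r ν γ I J) {i j : ι} (hij : i ≠ j)
    (hi : i ∉ S) (hj : j ∉ S) (hS : r * w j + w i = 0) (hiS : w i + ∑ k ∈ S, w k = 0)
    (hjS : w j + ∑ k ∈ S, w k = 0) : IsGood ν I J w := by
  intro x hx
  have hγ : ∀ a, γ (γ a) = a := fun a => by
    have := DFunLike.congr_fun h.pow_eq a
    simpa [pow_succ] using this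
  have key : ∀ u ∈ I, ν u = u → ∀ v, u * v + γ u * v ∈ J := fun u hu hu' v => by
    simpa [sum_range_succ, pow_succ] using h.sum_mem u hu hu' v
  have hprod : ∏ i, x i = x i * x j * (∏ k ∈ S, x k) * ∏ k ∈ univ \ insert i (insert j S), x k := by
    rw [← prod_sdiff (subset_univ (insert i (insert j S))), prod_insert, prod_insert hj]
    · ring
    · simp [hij, hi]
  have e1 := prod_invariant_of_sum_eq_zero (S := insert i S) (fun i => (hx i).2)
    (by rwa [sum_insert hi])
  have e2 := prod_invariant_of_sum_eq_zero (S := insert j S) (fun i => (hx i).2)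
    (by rwa [sum_insert hj])
  rw [prod_insert hi] at e1
  rw [prod_insert hj] at e2
  have e3 : ν (γ (x j) * x i) = γ (x j) * x i := by
    have := (h.weight _ _ (hx j).2).mul (hx i).2
    rwa [hS, isWeightVector_zero_iff] at this
  rw [hprod]
  have f1 := key _ (I.mul_mem_right _ (hx i).1) e1 (x j * ∏ k ∈ univ \ insert i (insert j S), x k)
  have f2 := key _ (I.mul_mem_right _ (hx j).1) e2 (x i * ∏ k ∈ univ \ insert i (insert j S), x k)
  have f3 := key _ (I.mul_mem_left _ (hx i).1) e3
    (γ (∏ k ∈ S, x k) * ∏ k ∈ univ \ insert i (insert j S), x k)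
  generalize (∏ k ∈ S, x k) = u at *
  generalize (∏ k ∈ univ \ insert i (insert j S), x k) = z at *
  refine Ideal.mem_of_natCast_mul_mem (n := 2) (by norm_num) ?_
  convert J.sub_mem (J.add_mem f1 f2) f3 using 1
  simp only [map_mul, hγ]
  push_cast
  ring

end IsMetacyclicIdeal

end Swapping


section LongProducts

open Finset

variable {p : ℕ} [Fact p.Prime] {A : Type} [CommRing A] [Algebra ℂ A] {q : ℕ} {r : ZMod p}
  {ν γ : A →ₐ[ℂ] A} {I J : Ideal A} {ι : Type} [DecidableEq ι] [Fintype ι] {w : ι → ZMod p}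

theorem hasZeroSums_univ_of_eq_zero {i : ι} (hi : w i = 0) (hc : q * p + 1 ≤ Fintype.card ι) :
    HasZeroSums w (q + 1) univ := by
  refine HasZeroSums.add_one (S := {i}) (hasZeroSums_of_mul_le_card ?_) (subset_univ _)
    (singleton_nonempty i) (by simpa)
  rw [card_sdiff_of_subset (subset_univ _), card_singleton, card_univ]
  omega

theorem card_ne_zero_weights : #((univ : Finset (ZMod p)).erase 0) = p - 1 := by
  rw [card_erase_of_mem (mem_univ _), card_univ, ZMod.card]

namespace IsMetacyclicIdeal

theorem isGood_two (h : IsMetacyclicIdeal 2 r ν γ I J) (hr : r ≠ 1) (hr' : r ^ 2 = 1)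
    (hc : p + 1 ≤ Fintype.card ι) : IsGood ν I J w := by
  have hr1 : r = -1 := (sq_eq_one_iff.1 hr').resolve_left hr
  by_cases h0 : ∃ i, w i = 0
  · obtain ⟨i, hi⟩ := h0
    exact h.isGood_of_hasZeroSums (hasZeroSums_univ_of_eq_zero hi (by omega))
  push Not at h0
  have hp := (Fact.out : p.Prime).two_le
  obtain ⟨i, -, j, -, hij, hw⟩ := exists_ne_map_eq_of_card_lt_of_maps_to (s := univ)
    (t := (univ : Finset (ZMod p)).erase 0) (f := w)
    (by rw [card_ne_zero_weights, card_univ]; omega) (by intro i _; simpa using h0 i)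
  obtain ⟨S, hS, hS'⟩ := exists_sum_eq (w := w) (T := univ \ {i, j}) (fun i _ => h0 i) (by
    rw [card_sdiff_of_subset (subset_univ _), card_pair hij, card_univ]
    omega) (-w i)
  refine h.isGood_of_isGood_two hij (S := S) (fun hi => ?_) (fun hj => ?_) ?_ ?_ ?_
  · simpa using hS hi
  · simpa using hS hj
  · rw [hr1, hw]; ring
  · rw [hS', add_neg_cancel]
  · rw [hS', hw, add_neg_cancel]

theorem isGood_of_hasPairs_two (h : IsMetacyclicIdeal 3 r ν γ I J) (hp : 7 ≤ p) {S : Finset ι}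
    (hS : S.Nonempty) (hS0 : ∑ i ∈ S, w i = 0) (hc : 2 * (p - 1) ≤ #(univ \ S))
    (hw : HasPairs w 2 (univ \ S)) : IsGood ν I J w :=
  h.isGood_of_hasZeroSums (HasZeroSums.add_one
    (HasPairs.hasZeroSums (q := 2) (k := 1) (s := p - 1) hw hc (by omega) (by omega))
    (subset_univ _) hS hS0)

theorem isGood_of_zero_sum_three (h : IsMetacyclicIdeal 3 r ν γ I J) (hr : r ≠ 1)
    (hp : 7 ≤ p) (h0 : ∀ i, w i ≠ 0) {S : Finset ι}
    (hS : S.Nonempty) (hS0 : ∑ i ∈ S, w i = 0) (hc : 2 * (p - 1) ≤ #(univ \ S)) :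
    IsGood ν I J w := by
  rcases hasPairs_or_exists_constant w 2 (univ \ S) with hw | ⟨k, hk, P, hP, hPc, -, a, ha⟩
  · exact h.isGood_of_hasPairs_two hp hS hS0 hc hw
  have hU : 2 * (p - 1) - 2 ≤ #((univ \ S) \ P) := by
    rw [card_sdiff_of_subset hP]; omega
  obtain ⟨R, hR, hRc⟩ := exists_subset_card_eq (s := (univ \ S) \ P) (n := p) (by omega)
  have hRne : R.Nonempty := card_pos.1 (by omega)
  have hRS : Disjoint R S :=
    disjoint_of_subset_left (hR.trans sdiff_subset) sdiff_disjoint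
  have hR0 : ∑ i ∈ R, w i = 0 := by
    rw [sum_congr rfl fun i hi => ha i (hR hi)]
    simp [hRc]
  refine h.isGood_of_isGood_three hRS hRne hS hR0 hS0 ?_
  refine h.isGood_of_hasPairs_two hp hS ?_ hc ?_
  · rw [sum_congr rfl fun i hi => by rw [if_neg (disjoint_right.1 hRS hi), if_pos hi],
      ← mul_sum, hS0, mul_zero]
  · refine HasPairs.mono (T := R ∪ (((univ \ S) \ P) \ R)) (hasPairs_union_of_ne ?_ ?_ ?_) ?_
    · omega
    · rw [card_sdiff_of_subset hR]; omega
    · intro i hi j hj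
      have hj' := mem_sdiff.1 hj
      rw [if_pos hi, if_neg hj'.2, if_neg (mem_sdiff.1 (mem_sdiff.1 hj'.1).1).2, ha i (hR hi),
        ha j hj'.1]
      intro heq
      have : a ≠ 0 := ha i (hR hi) ▸ h0 i
      exact hr (mul_right_cancel₀ this (by rw [heq, one_mul]))
    · exact union_subset (hR.trans sdiff_subset) (sdiff_subset.trans sdiff_subset)

theorem isGood_three (h : IsMetacyclicIdeal 3 r ν γ I J) (hr : r ≠ 1) (hr' : r ^ 3 = 1)
    (hp : 7 ≤ p) (hc : 2 * p + 1 ≤ Fintype.card ι) : IsGood ν I J w := by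
  have hr0 : r ≠ 0 := by rintro rfl; simp at hr'
  by_cases h0 : ∃ i, w i = 0
  · obtain ⟨i, hi⟩ := h0
    exact h.isGood_of_hasZeroSums (hasZeroSums_univ_of_eq_zero hi hc)
  push Not at h0
  obtain ⟨a, ha, hac⟩ := exists_lt_card_fiber_of_mul_lt_card_of_maps_to (s := univ) (n := 2)
    (t := (univ : Finset (ZMod p)).erase 0) (f := w) (by intro i _; simpa using h0 i)
    (by rw [card_ne_zero_weights, card_univ]; omega)
  obtain ⟨i, j, k, hi, hj, hk, hij, hik, hjk⟩ := two_lt_card_iff.1 hac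
  simp only [mem_filter, mem_univ, true_and] at hi hj hk
  have h3 : #({i, j, k} : Finset ι) = 3 := card_eq_three.2 ⟨i, j, k, hij, hik, hjk, rfl⟩
  have hT : 2 * (p - 1) ≤ #(univ \ {i, j, k}) := by
    rw [card_sdiff_of_subset (subset_univ _), h3, card_univ]; omega
  obtain ⟨R, hR, hRc⟩ := exists_subset_card_eq (s := univ \ {i, j, k}) (n := p - 1) (by omega)
  obtain ⟨S, hS, hS'⟩ := exists_sum_eq (w := w) (T := R) (fun i _ => h0 i) (by omega) (-a)
  obtain ⟨T, hT, hT'⟩ := exists_sum_eq (w := w) (T := (univ \ {i, j, k}) \ R) (fun i _ => h0 i)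
    (by rw [card_sdiff_of_subset hR]; omega) (-a)
  have hST : Disjoint S T := disjoint_of_subset_left hS
    (disjoint_of_subset_right hT disjoint_sdiff)
  have hSn : ∀ x ∈ S, x ∉ ({i, j, k} : Finset ι) := fun x hx => (mem_sdiff.1 (hR (hS hx))).2
  have hTn : ∀ x ∈ T, x ∉ ({i, j, k} : Finset ι) :=
    fun x hx => (mem_sdiff.1 (mem_sdiff.1 (hT hx)).1).2
  have hiS : i ∉ S := fun h => hSn i h (by simp)
  have hjS : j ∉ S := fun h => hSn j h (by simp)
  have hkS : k ∉ S := fun h => hSn k h (by simp)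
  have hiT : i ∉ T := fun h => hTn i h (by simp)
  have hjT : j ∉ T := fun h => hTn j h (by simp)
  have hkT : k ∉ T := fun h => hTn k h (by simp)
  refine h.isGood_of_isGood_three (S := insert i S) (T := insert j T) ?_ (insert_nonempty _ _)
    (insert_nonempty _ _) ?_ ?_ ?_
  · simp only [disjoint_insert_left, disjoint_insert_right, mem_insert, not_or]
    exact ⟨⟨hij.symm, hjS⟩, hiT, hST⟩
  · rw [sum_insert hiS, hS', hi, add_neg_cancel]
  · rw [sum_insert hjT, hT', hj, add_neg_cancel]
  refine h.isGood_of_zero_sum_three hr hp ?_ (S := {i, j, k}) (insert_nonempty _ _) ?_ ?_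
  · intro x
    split_ifs
    · exact mul_ne_zero hr0 (h0 x)
    · exact mul_ne_zero (pow_ne_zero 2 hr0) (h0 x)
    · exact h0 x
  · rw [sum_insert (by simp [hij, hik]), sum_pair hjk]
    simp only [mem_insert, true_or, if_true, hij.symm, hik.symm, hjk.symm, hjS, hkS, hkT, or_self,
      if_false, hi, hj, hk]
    have : (r - 1) * (r + r ^ 2 + 1) = 0 := by linear_combination hr'
    have := (mul_eq_zero.1 this).resolve_left (sub_ne_zero.2 hr)
    linear_combination a * this
  · assumption

theorem isGood_of_bounds (h : IsMetacyclicIdeal q r ν γ I J) (hq : 0 < q)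
    (hr : ∀ j, 0 < j → j < q → r ^ j ≠ 1) {κ s : ℕ} (hκ : 2 * κ < s) (hs : p ≤ s + κ)
    (hqp : q ≤ p) (hc : q * s ≤ Fintype.card ι) (hc' : 2 * (q * κ) + p ≤ Fintype.card ι + 1) :
    IsGood ν I J w := by
  have hgood : ∀ w : ι → ZMod p, HasPairs w (q * κ) univ → IsGood ν I J w := fun w hw =>
    h.isGood_of_hasZeroSums (hw.hasZeroSums (by rwa [card_univ]) hκ hs)
  have hp := (Fact.out : p.Prime).pos
  rcases hasPairs_or_exists_constant w (q * κ) univ with hw | ⟨k, hk, P, hP, hPc, hPw, a, ha⟩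
  · exact hgood w hw
  have hL : #(univ \ P) = Fintype.card ι - 2 * k := by
    rw [card_sdiff_of_subset hP, hPc, card_univ]
  by_cases ha0 : a = 0
  · subst ha0
    exact h.isGood_of_hasZeroSums
      ((hasZeroSums_of_eq_zero (by omega) ha).mono (subset_univ (univ \ P)))
  obtain ⟨n, hn, hn'⟩ : ∃ n, q * κ - k ≤ p * n ∧ p * n ≤ q * κ - k + (p - 1) := by
    refine ⟨(q * κ - k + (p - 1)) / p, ?_, Nat.mul_div_le _ _⟩
    have := Nat.lt_mul_div_succ (q * κ - k + (p - 1)) hp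
    rw [mul_add] at this
    omega
  obtain ⟨S, hS, hSc⟩ := exists_subset_card_eq (s := univ \ P) (n := p * n) (by omega)
  refine h.isGood_of_forall_isGood hq (S := S) (card_pos.1 (by omega)) ?_ fun j hj hjq =>
    hgood _ ?_
  · rw [sum_congr rfl fun i hi => ha i (hS hi)]
    simp [hSc]
  · have hPS : Disjoint P S := disjoint_of_subset_right hS disjoint_sdiff
    have h1 := hPw.congr (w' := fun i => if i ∈ S then r ^ j * w i else w i) fun i hi => by
      rw [if_neg (disjoint_left.1 hPS hi)]
    have h2 : HasPairs (fun i => if i ∈ S then r ^ j * w i else w i) (q * κ - k)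
        (S ∪ ((univ \ P) \ S)) := by
      refine hasPairs_union_of_ne (by omega) (by rw [card_sdiff_of_subset hS]; omega) ?_
      intro x hx y hy
      rw [if_pos hx, if_neg (mem_sdiff.1 hy).2, ha x (hS hx), ha y (mem_sdiff.1 hy).1]
      intro heq
      exact hr j hj hjq (mul_right_cancel₀ ha0 (by rw [heq, one_mul]))
    rw [union_sdiff_of_subset hS] at h2
    have h3 := (h1.union h2 disjoint_sdiff).mono (subset_univ _)
    rwa [Nat.add_sub_cancel' hk.le] at h3

/-- The main estimate for `IsGood`. -/
theorem isGood (h : IsMetacyclicIdeal q r ν γ I J) (hq : q.Prime) (hr : r ≠ 1) (hr' : r ^ q = 1)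
    (hc : 3 * (p * q) / 4 ≤ Fintype.card ι) : IsGood ν I J w := by
  have hp : p.Prime := Fact.out
  have := Fact.mk hq
  have hr0 : r ≠ 0 := by rintro rfl; simp [hq.ne_zero] at hr'
  have hord : orderOf r = q := orderOf_eq_prime hr' hr
  have hdvd : q ∣ p - 1 := hord ▸ ZMod.orderOf_dvd_card_sub_one hr0
  have hp2 := hp.two_le
  have hqp := Nat.le_of_dvd (by omega) hdvd
  rcases hq.two_le.eq_or_lt with rfl | hq2
  · exact h.isGood_two hr hr' (by omega)
  rcases hp.eq_two_or_odd with rfl | hodd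
  · omega
  rcases (show 3 ≤ q from hq2).eq_or_lt with rfl | hq3
  · have h4 : p ≠ 4 := by rintro rfl; norm_num at hp
    exact h.isGood_three hr hr' (by omega) (by omega)
  have hqodd := hq.eq_two_or_odd
  obtain ⟨t, ht⟩ := hdvd
  have ht2 : 2 ≤ t := by
    rcases t with _ | _ | t
    · omega
    · omega
    · omega
  have hpq := Nat.mul_le_mul_left q ht2
  have hbound : 2 * (q * (p / 4 + 1)) + p ≤ 3 * (p * q) / 4 + 1 := by
    rcases Nat.lt_or_ge q 7 with hq7 | hq7
    · have hq5 : q = 5 := by omega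
      subst hq5
      have h21 : p ≠ 21 := by rintro rfl; norm_num at hp
      omega
    · have h1 : 4 * (p / 4 + 1) ≤ p + 3 := by omega
      have h2 := Nat.mul_le_mul_left (2 * q) h1
      have h3 : 27 ≤ (p - 6) * (q - 4) := Nat.mul_le_mul (show 9 ≤ p - 6 by omega) (show 3 ≤ q - 4 by omega)
      zify [show 6 ≤ p by omega, show 4 ≤ q by omega] at h3
      have h4 : 2 * q * (p + 3) + 4 * p ≤ 3 * (p * q) + 1 := by zify; linarith
      have h5 : 2 * q * (4 * (p / 4 + 1)) = 4 * (2 * (q * (p / 4 + 1))) := by ring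
      omega
  refine h.isGood_of_bounds hq.pos (fun j hj hjq => ?_) (κ := p / 4 + 1) (s := p - (p / 4 + 1))
    (by omega) (by omega) (by omega) (le_trans ?_ hc) (by omega)
  · exact pow_ne_one_of_lt_orderOf hj.ne' (by rwa [hord])
  · rw [Nat.le_div_iff_mul_le (by norm_num)]
    have h1 : 4 * (p - (p / 4 + 1)) ≤ 3 * p := by omega
    nlinarith

end IsMetacyclicIdeal

end LongProducts


section HilbertBounds

open Finset ZMod

open MvPolynomial in
/-- The Davenport constant of a group of rank two and exponent `p` is at most `2 * p - 1`. -/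
theorem exists_zero_sum_pair {p : ℕ} [Fact p.Prime] {ι : Type} [Fintype ι]
    (hc : 2 * p - 1 ≤ Fintype.card ι) (a b : ι → ZMod p) :
    ∃ S : Finset ι, S.Nonempty ∧ ∑ i ∈ S, a i = 0 ∧ ∑ i ∈ S, b i = 0 := by
  classical
  have hp : p.Prime := Fact.out
  let f : (ι → ZMod p) → MvPolynomial ι (ZMod p) := fun a => ∑ i, a i • X i ^ (p - 1)
  have hdeg : ∀ a, (f a).totalDegree ≤ p - 1 := fun a => by
    apply totalDegree_finsetSum_le
    exact fun i _ => (totalDegree_smul_le ..).trans (totalDegree_X_pow ..).le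
  have hdvd := char_dvd_card_solutions_of_add_lt p (f₁ := f a) (f₂ := f b) (by
    have := hdeg a
    have := hdeg b
    have := hp.two_le
    omega)
  let zero_sol : {x // eval x (f a) = 0 ∧ eval x (f b) = 0} :=
    ⟨0, by simp [f, map_sum, hp.one_lt, tsub_eq_zero_iff_le]⟩
  obtain ⟨x, hx⟩ := Fintype.exists_ne_of_one_lt_card
    (hp.one_lt.trans_le <| Nat.le_of_dvd (Fintype.card_pos_iff.2 ⟨zero_sol⟩) hdvd) zero_sol
  refine ⟨({i | x.1 i ≠ 0} : Finset _), ?_, ?_, ?_⟩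
  · rw [← Subtype.coe_ne_coe, Function.ne_iff] at hx
    exact hx.imp fun i hi => mem_filter.2 ⟨mem_univ _, hi⟩
  · simpa [f, ZMod.pow_card_sub_one, sum_filter] using x.2.1
  · simpa [f, ZMod.pow_card_sub_one, sum_filter] using x.2.2

variable {G A : Type} [Group G] [CommRing A] [Algebra ℂ A] (φ : G →* (A →ₐ[ℂ] A))

theorem apply_eq_of_mem_closure {s : Set G} {a : A} (h : ∀ g ∈ s, φ g a = a) {g : G}
    (hg : g ∈ Subgroup.closure s) : φ g a = a := by
  induction hg using Subgroup.closure_induction with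
  | mem x hx => exact h x hx
  | one => simp
  | mul x y _ _ hx hy => rw [map_mul_apply_of_action, hy, hx]
  | inv x _ hx =>
    conv_lhs => rw [← hx]
    rw [← map_mul_apply_of_action, inv_mul_cancel, map_one, AlgHom.one_apply]

theorem toLinearMap_pow_eq_one {g : G} {p : ℕ} (hg : g ^ p = 1) :
    (φ g).toLinearMap ^ p = 1 := by
  have h : φ g ^ p = 1 := by rw [← map_pow, hg, map_one]
  ext a
  simpa [Module.End.pow_apply, AlgHom.coe_pow] using DFunLike.congr_fun h a

theorem IsWeightVector.pow {p : ℕ} [NeZero p] {ν : A →ₐ[ℂ] A} {k : ZMod p} {a : A}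
    (ha : IsWeightVector ν k a) (m : ℕ) : IsWeightVector (ν ^ m) ((m : ZMod p) * k) a := by
  induction m with
  | zero => simp [IsWeightVector]
  | succ m ih =>
    rw [IsWeightVector, pow_succ, AlgHom.mul_apply, ha, _root_.map_smul, ih, smul_smul,
      ← AddChar.map_add_eq_mul]
    congr 2
    push_cast
    ring

theorem hasHilbertBound_of_commute {p : ℕ} [Fact p.Prime] {n g : G} (hn : n ^ p = 1)
    (hg : g ^ p = 1) (hng : n * g = g * n) (hgen : Subgroup.closure {n, g} = ⊤) :
    HasHilbertBound G (2 * p - 1) := by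
  intro A _ _ φ I hI
  set J := Ideal.span {a | a ∈ I ∧ ∀ g, φ g a = a}
  have hle := le_span_weightVectors₂ (ν := φ n) (μ := φ g) (toLinearMap_pow_eq_one φ hn)
    (toLinearMap_pow_eq_one φ hg)
    (fun a => by rw [← map_mul_apply_of_action, ← hng, map_mul_apply_of_action]) I (hI n) (hI g)
  refine (Ideal.pow_right_mono hle _).trans ?_
  rw [← Fintype.card_fin (2 * p - 1)]
  refine Ideal.span_pow_le_of_prod_mem fun x hx => ?_
  choose hxI k l hk hl using hx
  obtain ⟨S, hS, hSk, hSl⟩ := exists_zero_sum_pair (Fintype.card_fin _).ge k l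
  rw [← prod_sdiff (subset_univ S)]
  refine J.mul_mem_left _ (Ideal.subset_span ⟨prod_mem_of_nonempty hxI hS, fun h => ?_⟩)
  refine apply_eq_of_mem_closure φ (s := {n, g}) ?_ (hgen ▸ Subgroup.mem_top h)
  rintro _ (rfl | rfl)
  · exact prod_invariant_of_sum_eq_zero hk hSk
  · exact prod_invariant_of_sum_eq_zero hl hSl

theorem isMetacyclicIdeal_span [Finite G] {p q : ℕ} [NeZero p] {n g : G} {r : ℕ}
    (hN : (Subgroup.zpowers n).index = q) (hg : g ^ q = 1) (hng : n * g = g * n ^ r)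
    (hgen : Subgroup.closure {n, g} = ⊤) (I : Ideal A) (hI : ∀ g, ∀ a ∈ I, φ g a ∈ I) :
    IsMetacyclicIdeal q (r : ZMod p) (φ n) (φ g) I (Ideal.span {a | a ∈ I ∧ ∀ g, φ g a = a}) := by
  have hpow : φ g ^ q = 1 := by rw [← map_pow, hg, map_one]
  have hweight : ∀ (k : ZMod p) (a : A), IsWeightVector (φ n) k a →
      IsWeightVector (φ n) ((r : ZMod p) * k) (φ g a) := fun k a ha => by
    rw [IsWeightVector, ← map_mul_apply_of_action, hng, map_mul_apply_of_action, map_pow,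
      ha.pow r, _root_.map_smul]
  refine ⟨hI g, hweight, fun u hu hu' v => ?_, ?_, hpow⟩
  · rw [← sum_mul]
    refine Ideal.mul_mem_right _ _ (Ideal.subset_span ⟨I.sum_mem fun j _ => ?_, fun h => ?_⟩)
    · rw [← map_pow]; exact hI _ _ hu
    · refine apply_eq_of_mem_closure φ (s := {n, g}) ?_ (hgen ▸ Subgroup.mem_top h)
      intro x hx
      obtain hx | hx : x = n ∨ x = g := hx <;> rw [hx, map_sum]
      · refine sum_congr rfl fun j _ => ?_
        clear * - u hu' hweight
        induction j with
        | zero => simpa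
        | succ j ih =>
          have := hweight 0 _ (isWeightVector_zero_iff.2 ih)
          rw [mul_zero, isWeightVector_zero_iff] at this
          rwa [pow_succ', AlgHom.mul_apply]
      · have h1 := (sum_range_succ (fun j => (φ g ^ j) u) q).symm.trans
          (sum_range_succ' (fun j => (φ g ^ j) u) q)
        simp only [hpow, pow_zero, AlgHom.one_apply, pow_succ', AlgHom.mul_apply] at h1
        exact (add_right_cancel h1).symm
  · have h := span_invariants_pow_index_le φ (Subgroup.zpowers n) I hI
    rw [hN] at h
    refine le_trans (Ideal.pow_right_mono (Ideal.span_mono ?_) _) h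
    rintro a ⟨haI, ha⟩
    refine ⟨haI, fun h hh => ?_⟩
    rw [Subgroup.zpowers_eq_closure] at hh
    exact apply_eq_of_mem_closure φ (by simpa using ha) hh

theorem hasHilbertBound_of_metacyclic [Finite G] {p q : ℕ} [Fact p.Prime] (hq : q.Prime) {n g : G}
    {r : ℕ} (hn : n ^ p = 1) (hN : (Subgroup.zpowers n).index = q) (hg : g ^ q = 1)
    (hng : n * g = g * n ^ r) (hgen : Subgroup.closure {n, g} = ⊤) (hr : (r : ZMod p) ≠ 1)
    (hr' : (r : ZMod p) ^ q = 1) : HasHilbertBound G (3 * (p * q) / 4) := by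
  intro A _ _ φ I hI
  have hJ := isMetacyclicIdeal_span (p := p) φ hN hg hng hgen I hI
  have hle := le_span_weightVectors (ν := φ n) (toLinearMap_pow_eq_one φ hn) I (hI n)
  refine (Ideal.pow_right_mono hle _).trans ?_
  rw [← Fintype.card_fin (3 * (p * q) / 4)]
  refine Ideal.span_pow_le_of_prod_mem fun x hx => ?_
  choose hxI k hk using hx
  exact hJ.isGood hq hr hr' (Fintype.card_fin _).ge x fun i => ⟨hxI i, hk i⟩

end HilbertBounds


section MinimalNonCyclic

open Subgroup

variable {G : Type} [Group G]

theorem normal_zpowers_of_mem_center {c : G} (hc : c ∈ center G) : (zpowers c).Normal := by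
  refine ⟨fun x hx g => ?_⟩
  rwa [mem_center_iff.1 (zpowers_le.2 hc hx) g, mul_inv_cancel_right]

theorem mem_zpowers_of_pow_eq_one [Finite G] [IsCyclic G] {p : ℕ} (hp : 0 < p) {a b : G}
    (ha : orderOf a = p) (hb : b ^ p = 1) : b ∈ zpowers a := by
  classical
  have := Fintype.ofFinite G
  have hsub : (Finset.range p).image (a ^ ·) ⊆ Finset.univ.filter fun x : G => x ^ p = 1 := by
    intro x hx
    obtain ⟨i, -, rfl⟩ := Finset.mem_image.1 hx
    rw [Finset.mem_filter, ← ha, pow_right_comm, pow_orderOf_eq_one, one_pow]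
    exact ⟨Finset.mem_univ _, rfl⟩
  have hcard : ((Finset.range p).image (a ^ ·)).card = p := by
    rw [Finset.card_image_of_injOn, Finset.card_range]
    rw [← ha]
    simpa using pow_injOn_Iio_orderOf (x := a)
  have heq := Finset.eq_of_subset_of_card_le hsub
    ((IsCyclic.card_pow_eq_one_le hp).trans hcard.ge)
  have hb' : b ∈ (Finset.range p).image (a ^ ·) := by
    rw [heq]
    simpa using hb
  obtain ⟨i, -, rfl⟩ := Finset.mem_image.1 hb'
  exact pow_mem (mem_zpowers a) i

theorem mul_comm_of_closure_eq_top {a b : G} (hgen : closure {a, b} = ⊤) (hab : a * b = b * a)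
    (x y : G) : x * y = y * x := by
  have := isMulCommutative_closure (k := ({a, b} : Set G)) (by
    rintro _ (rfl | rfl) _ (rfl | rfl) <;> first | rfl | exact hab | exact hab.symm)
  have h : ∀ x : G, x ∈ closure ({a, b} : Set G) := fun x => hgen ▸ mem_top x
  exact congrArg Subtype.val (mul_comm' (⟨x, h x⟩ : closure ({a, b} : Set G)) ⟨y, h y⟩)

theorem exists_closure_pair_eq_top (n : G) [(zpowers n).Normal] [IsCyclic (G ⧸ zpowers n)] :
    ∃ g : G, closure {n, g} = ⊤ := by
  obtain ⟨x, hx⟩ := IsCyclic.exists_generator (α := G ⧸ zpowers n)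
  obtain ⟨g, rfl⟩ := QuotientGroup.mk_surjective x
  refine ⟨g, eq_top_iff.2 fun y _ => ?_⟩
  obtain ⟨k, hk⟩ := mem_zpowers_iff.1 (hx y)
  rw [← QuotientGroup.mk_zpow, QuotientGroup.eq] at hk
  have hle : zpowers n ≤ closure {n, g} := zpowers_le.2 (subset_closure (by simp))
  have := mul_mem (zpow_mem (subset_closure (by simp : g ∈ ({n, g} : Set G))) k) (hle hk)
  simpa using this

theorem mul_comm_of_mem_closure_of_isCyclic {a b : G} (h : IsCyclic (closure {a, b})) :
    a * b = b * a :=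
  congrArg Subtype.val (mul_comm' (⟨a, subset_closure (by simp)⟩ : closure ({a, b} : Set G))
    ⟨b, subset_closure (by simp)⟩)

variable (hquot : ∀ (N : Subgroup G) [N.Normal], N ≠ ⊥ → IsCyclic (G ⧸ N))
include hquot

theorem mul_comm_of_mem_center {c : G} (hc : c ∈ center G) (hc' : c ≠ 1) (x y : G) :
    x * y = y * x := by
  have hle : zpowers c ≤ center G := zpowers_le.2 hc
  have : (zpowers c).Normal := normal_zpowers_of_mem_center hc
  have := hquot (zpowers c) (by simpa using hc')
  have := (QuotientGroup.mk' (zpowers c)).isMulCommutative_of_isCyclic_of_ker_le_center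
    (by rwa [QuotientGroup.ker_mk'])
  exact mul_comm' x y

variable [Finite G] (hG : ¬ IsCyclic G) (hsub : ∀ H : Subgroup G, H ≠ ⊤ → IsCyclic H)
include hG hsub

theorem exists_commuting_generators_of_isPGroup {p : ℕ} [Fact p.Prime] (hp : IsPGroup p G) :
    ∃ n g : G, n ^ p = 1 ∧ g ^ p = 1 ∧ n * g = g * n ∧ closure {n, g} = ⊤ := by
  have hpp : p.Prime := Fact.out
  have := Nontrivial.of_not_isCyclic hG
  have hcen := hp.center_nontrivial
  have hcp : p ∣ Nat.card (center G) := by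
    obtain ⟨k, hk⟩ := IsPGroup.iff_card.1 (hp.to_subgroup (center G))
    rw [hk]
    refine dvd_pow_self p ?_
    rintro rfl
    exact (Finite.one_lt_card (α := center G)).ne' (by rw [hk, pow_zero])
  obtain ⟨z, hz⟩ := exists_prime_orderOf_dvd_card' p hcp
  obtain ⟨n, hn⟩ := z
  rw [orderOf_mk] at hz
  have hn1 : n ≠ 1 := by
    rintro rfl
    exact hpp.one_lt.ne (by simpa using hz)
  have hcomm := mul_comm_of_mem_center hquot hn hn1
  have : (zpowers n).Normal := normal_zpowers_of_mem_center hn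
  have := hquot (zpowers n) (by simpa using hn1)
  obtain ⟨g, hgen⟩ := exists_closure_pair_eq_top n
  have hng : n ∉ zpowers g := by
    intro h
    refine hG (isCyclic_iff_exists_zpowers_eq_top.2 ⟨g, ?_⟩)
    rw [eq_top_iff, ← hgen, closure_le]
    rintro _ (rfl | rfl)
    · exact h
    · exact mem_zpowers _
  obtain ⟨k, hk⟩ := IsPGroup.iff_orderOf.1 hp g
  cases k with
  | zero =>
    rw [pow_zero, orderOf_eq_one_iff] at hk
    refine absurd (isCyclic_iff_exists_zpowers_eq_top.2 ⟨n, ?_⟩) hG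
    rw [← hgen, hk, zpowers_eq_closure, Set.pair_comm, closure_insert_one]
  | succ k =>
    have hord : orderOf (g ^ p ^ k) = p := by
      rw [orderOf_pow_of_dvd (pow_ne_zero _ hpp.ne_zero) (hk ▸ pow_dvd_pow p k.le_succ), hk,
        pow_succ, Nat.mul_div_cancel_left _ (pow_pos hpp.pos k)]
    refine ⟨n, g ^ p ^ k, hz ▸ pow_orderOf_eq_one n, ?_, hcomm _ _, ?_⟩
    · rw [← orderOf_dvd_iff_pow_eq_one, hord]
    by_contra hne
    have := hsub _ hne
    have hmem := mem_zpowers_of_pow_eq_one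
      (a := (⟨g ^ p ^ k, subset_closure (by simp)⟩ : closure {n, g ^ p ^ k}))
      (b := ⟨n, subset_closure (by simp)⟩) hpp.pos (by rwa [orderOf_mk])
      (Subtype.ext (hz ▸ pow_orderOf_eq_one n))
    obtain ⟨m, hm⟩ := mem_zpowers_iff.1 hmem
    refine hng ?_
    have hm' : (g ^ p ^ k) ^ m = n := congrArg Subtype.val hm
    exact hm' ▸ zpow_mem (pow_mem (mem_zpowers g) _) m

theorem exists_metacyclic_generators [IsZGroup G] :
    ∃ p q : ℕ, p.Prime ∧ q.Prime ∧ Nat.card G = p * q ∧ ∃ (n g : G) (r : ℕ), n ^ p = 1 ∧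
      (zpowers n).index = q ∧ g ^ q = 1 ∧ n * g = g * n ^ r ∧ closure {n, g} = ⊤ ∧
      (r : ZMod p) ≠ 1 ∧ (r : ZMod p) ^ q = 1 := by
  have := Nontrivial.of_not_isCyclic hG
  have hncomm : ¬ ∀ x y : G, x * y = y * x := fun h => by
    have : IsMulCommutative G := ⟨⟨h⟩⟩
    let _ : CommGroup G := { ‹Group G› with mul_comm := h }
    exact hG inferInstance
  have hcom : Nat.card (commutator G) ≠ 1 := by
    rw [Ne, card_eq_one, commutator_def, commutator_eq_bot_iff_le_centralizer]
    exact fun h => hncomm fun x y => mem_centralizer_iff.1 (h (mem_top y)) x (mem_top x)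
  obtain ⟨p, hp, hpd⟩ := Nat.exists_prime_and_dvd hcom
  have := Fact.mk hp
  obtain ⟨⟨n, hnc⟩, hn⟩ := exists_prime_orderOf_dvd_card' p hpd
  rw [orderOf_mk] at hn
  have hn1 : n ≠ 1 := by
    rintro rfl
    exact hp.one_lt.ne (by simpa using hn)
  have hcyc : IsCyclic (commutator G) := IsZGroup.isCyclic_commutator G
  have hnp : n ^ p = 1 := hn ▸ pow_orderOf_eq_one n
  have hconj : ∀ g : G, g * n * g⁻¹ ∈ zpowers n := fun g => by
    have hmem := mem_zpowers_of_pow_eq_one (a := (⟨n, hnc⟩ : commutator G))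
      (b := ⟨g * n * g⁻¹, Normal.conj_mem inferInstance n hnc g⟩) hp.pos (by rwa [orderOf_mk])
      (Subtype.ext (by simp [conj_pow, hnp]))
    obtain ⟨m, hm⟩ := mem_zpowers_iff.1 hmem
    exact ⟨m, congrArg Subtype.val hm⟩
  have hN : (zpowers n).Normal := by
    refine ⟨fun x hx g => ?_⟩
    obtain ⟨k, rfl⟩ := mem_zpowers_iff.1 hx
    rw [← conj_zpow]
    exact zpow_mem (hconj g) k
  have hQ := hquot (zpowers n) (by simpa using hn1)
  have hex : ∃ d, ∃ g : G, closure {n, g} = ⊤ ∧ orderOf g = d :=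
    let ⟨g, hg⟩ := exists_closure_pair_eq_top n
    ⟨_, g, hg, rfl⟩
  classical
  obtain ⟨g, hgen, hgd⟩ := Nat.find_spec hex
  have hmin : ∀ x : G, orderOf x < orderOf g → closure {n, x} ≠ ⊤ := fun x hx h =>
    Nat.find_min hex (hgd ▸ hx) ⟨x, h, rfl⟩
  have hng : n * g ≠ g * n := fun h => hncomm (mul_comm_of_closure_eq_top hgen h)
  have hg1 : orderOf g ≠ 1 := by
    rw [Ne, orderOf_eq_one_iff]
    rintro rfl
    simp at hng
  obtain ⟨q, hq, hqd⟩ := Nat.exists_prime_and_dvd hg1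
  have hgq : g ^ q = 1 := by
    by_contra hne
    have hlt : orderOf (g ^ q) < orderOf g := by
      rw [orderOf_pow_of_dvd hq.ne_zero hqd]
      exact Nat.div_lt_self (orderOf_pos g) hq.one_lt
    have hc := mul_comm_of_mem_closure_of_isCyclic (hsub _ (hmin _ hlt))
    refine hncomm (mul_comm_of_mem_center hquot (c := g ^ q) ?_ hne)
    have hle : closure {n, g} ≤ centralizer {g ^ q} := by
      rw [closure_le]
      rintro _ (rfl | rfl)
      · simpa [mem_centralizer_iff] using hc.symm
      · simp [mem_centralizer_iff, ← pow_succ, ← pow_succ']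
    rw [hgen] at hle
    exact mem_center_iff.2 fun x => (mem_centralizer_iff.1 (hle (mem_top x)) _ rfl).symm
  have hidx : (zpowers n).index = q := by
    have htop : zpowers (g : G ⧸ zpowers n) = ⊤ := by
      have h := congrArg (map (QuotientGroup.mk' (zpowers n))) hgen
      rw [MonoidHom.map_closure, map_top_of_surjective _ (QuotientGroup.mk'_surjective _),
        Set.image_pair] at h
      have h1 : QuotientGroup.mk' (zpowers n) n = 1 := by simp
      rw [h1, closure_insert_one, ← zpowers_eq_closure] at h
      exact h
    have hcard : (zpowers n).index = orderOf (g : G ⧸ zpowers n) := by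
      rw [← Nat.card_zpowers, htop, card_top, index]
    have hdvd : (zpowers n).index ∣ q := by
      rw [hcard]
      refine orderOf_dvd_of_pow_eq_one ?_
      rw [← QuotientGroup.mk_pow, hgq, QuotientGroup.mk_one]
    refine (hq.eq_one_or_self_of_dvd _ hdvd).resolve_left fun h => ?_
    exact hG (isCyclic_iff_exists_zpowers_eq_top.2 ⟨n, index_eq_one.1 h⟩)
  obtain ⟨r, hr⟩ : ∃ r : ℕ, n ^ r = g⁻¹ * n * g := by
    have h := hconj g⁻¹
    rw [inv_inv, ← mem_powers_iff_mem_zpowers] at h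
    exact h
  have hgr : n * g = g * n ^ r := by rw [hr]; group
  have hiter : ∀ j : ℕ, n * g ^ j = g ^ j * n ^ r ^ j := fun j => by
    induction j with
    | zero => simp
    | succ j ih =>
      have h : n ^ r ^ j * g = g * n ^ r ^ (j + 1) := by
        have hs : SemiconjBy g (n ^ r) n := hgr.symm
        rw [pow_succ', pow_mul]
        exact (hs.pow_right _).eq.symm
      rw [pow_succ g, ← mul_assoc, ih, mul_assoc, h, ← mul_assoc]
  refine ⟨p, q, hp, hq, ?_, n, g, r, hnp, hidx, hgq, hgr, hgen, fun h => hng ?_, ?_⟩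
  · rw [← hidx, ← hn, ← Nat.card_zpowers, card_mul_index]
  · have h' : r ≡ 1 [MOD orderOf n] := by
      rw [hn, ← ZMod.natCast_eq_natCast_iff]
      simpa using h
    rw [hgr, pow_eq_pow_iff_modEq.2 h', pow_one]
  · have h := hiter q
    rw [hgq, mul_one, one_mul] at h
    have h' := pow_eq_pow_iff_modEq.1 ((pow_one n).trans h)
    rw [hn, ← ZMod.natCast_eq_natCast_iff] at h'
    simpa using h'.symm

end MinimalNonCyclic


section NonCyclic

theorem HasHilbertBound.three_quarters_of_subgroup {G : Type} [Group G] [Finite G] (H : Subgroup G)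
    (h : HasHilbertBound H (3 * Nat.card H / 4)) : HasHilbertBound G (3 * Nat.card G / 4) := by
  refine (h.of_subgroup H).mono ?_
  rw [← H.index_mul_card, mul_comm, mul_left_comm]
  exact Nat.mul_div_le_mul_div_assoc ..

theorem HasHilbertBound.three_quarters_of_quotient {G : Type} [Group G] [Finite G] (N : Subgroup G)
    [N.Normal] (h : HasHilbertBound (G ⧸ N) (3 * Nat.card (G ⧸ N) / 4)) :
    HasHilbertBound G (3 * Nat.card G / 4) := by
  refine ((hasHilbertBound_card N).of_quotient N h).mono ?_
  rw [N.card_eq_card_quotient_mul_card_subgroup, ← mul_assoc, mul_comm (3 * _) (Nat.card N)]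
  exact Nat.mul_div_le_mul_div_assoc ..

theorem exists_isPGroup_of_not_isZGroup {G : Type} [Group G] (hZ : ¬ IsZGroup G)
    (hsub : ∀ H : Subgroup G, H ≠ ⊤ → IsCyclic H) : ∃ p : ℕ, p.Prime ∧ IsPGroup p G := by
  rw [isZGroup_iff] at hZ
  push Not at hZ
  obtain ⟨p, hp, P, hP⟩ := hZ
  have htop : (P : Subgroup G) = ⊤ := by
    by_contra h
    exact hP (hsub _ h)
  refine ⟨p, hp, ?_⟩
  have h := P.isPGroup'
  rw [htop] at h
  exact h.of_equiv Subgroup.topEquiv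

theorem hasHilbertBound_of_not_isCyclic (G : Type) [Group G] [Finite G] (hG : ¬ IsCyclic G) :
    HasHilbertBound G (3 * Nat.card G / 4) := by
  induction hc : Nat.card G using Nat.strong_induction_on generalizing G with
  | _ c ih =>
  subst hc
  by_cases hsub : ∀ H : Subgroup G, H ≠ ⊤ → IsCyclic H
  swap
  · push Not at hsub
    obtain ⟨H, hH, hHc⟩ := hsub
    refine .three_quarters_of_subgroup H (ih _ ?_ H hHc rfl)
    exact lt_of_le_of_ne H.card_le_card_group (mt H.card_eq_iff_eq_top.1 hH)
  by_cases hquot : ∀ (N : Subgroup G) [N.Normal], N ≠ ⊥ → IsCyclic (G ⧸ N)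
  swap
  · push Not at hquot
    obtain ⟨N, _, hN, hNc⟩ := hquot
    refine .three_quarters_of_quotient N (ih _ ?_ (G ⧸ N) hNc rfl)
    rw [N.card_eq_card_quotient_mul_card_subgroup]
    exact lt_mul_of_one_lt_right Nat.card_pos (N.one_lt_card_iff_ne_bot.2 hN)
  by_cases hZ : IsZGroup G
  · obtain ⟨p, q, hp, hq, hcard, n, g, r, hn, hN, hg, hng, hgen, hr, hr'⟩ :=
      exists_metacyclic_generators hquot hG hsub
    have := Fact.mk hp
    rw [hcard]
    exact hasHilbertBound_of_metacyclic hq hn hN hg hng hgen hr hr'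
  · obtain ⟨p, hp, hpG⟩ := exists_isPGroup_of_not_isZGroup hZ hsub
    have := Fact.mk hp
    obtain ⟨n, g, hn, hg, hng, hgen⟩ := exists_commuting_generators_of_isPGroup hquot hG hsub hpG
    refine (hasHilbertBound_of_commute hn hg hng hgen).mono ?_
    obtain ⟨k, hk⟩ := IsPGroup.iff_card.1 hpG
    have hk2 : 2 ≤ k := by
      by_contra! h
      interval_cases k
      · have := Nontrivial.of_not_isCyclic hG
        exact (Finite.one_lt_card (α := G)).ne' (by rw [hk, pow_zero])
      · exact hG (isCyclic_of_prime_card (p := p) (by rwa [pow_one] at hk))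
    have hle : p ^ 2 ≤ Nat.card G := hk ▸ Nat.pow_le_pow_right hp.pos hk2
    have hp2 := hp.two_le
    rw [Nat.le_div_iff_mul_le (by norm_num)]
    obtain ⟨m, rfl⟩ := Nat.exists_eq_add_of_le hp2
    have : 2 * (2 + m) - 1 = 2 * m + 3 := by omega
    rw [this]
    nlinarith

end NonCyclic


/-- **Theorem (Domokos–Hegedűs, Sezer).**  For any finite non-cyclic group `G` we
have `β(G) ≤ (3/4)·|G|`. -/
theorem noetherNumber_le_three_quarters
    (G : Type) [Group G] [Finite G] (hnc : ¬ IsCyclic G) :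
    (noetherNumber G : ℝ) ≤ (3 / 4 : ℝ) * (Nat.card G : ℝ) := by
  have h := noetherNumber_le_of_hasHilbertBound (hasHilbertBound_of_not_isCyclic G hnc)
  calc (noetherNumber G : ℝ) ≤ ((3 * Nat.card G / 4 : ℕ) : ℝ) := by exact_mod_cast h
    _ ≤ ((3 * Nat.card G : ℕ) : ℝ) / (4 : ℕ) := Nat.cast_div_le
    _ = 3 / 4 * Nat.card G := by push_cast; ring
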